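/- arXiv:2102.04748 — 2 statements merged into one kernel-verified Lean document; each statement's English description precedes it below -/
import Mathlib

section
/- Let d ∈ ℕ and k ∈ ℕ with k < d. There is a constant C > 0 such that for every f ∈ L_1(ℝ^d) and every t > 0, t^k ∫_{t^d}^∞ u^{1 − k/d} f^{**}(u) du/u ≤ C · ω_k(f,t)_1. -/
open MeasureTheory ENNReal Set Filter

noncomputable section

abbrev Euc (d : ℕ) := EuclideanSpace ℝ (Fin d)

/-- Non-increasing rearrangement of an `ℝ≥0∞`-valued function w.r.t. a measure. -/
def rearr {α : Type*} [MeasurableSpace α] (μ : Measure α) (g : α → ℝ≥0∞) (t : ℝ) : ℝ≥0∞ :=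
  sInf {l : ℝ≥0∞ | μ {x | l < g x} ≤ ENNReal.ofReal t}

/-- Non-increasing rearrangement of a real-valued function. -/
def rearrR {α : Type*} [MeasurableSpace α] (μ : Measure α) (f : α → ℝ) (t : ℝ) : ℝ≥0∞ :=
  rearr μ (fun x => ENNReal.ofReal |f x|) t

/-- The maximal function `f^{**}(t) = t⁻¹ ∫_0^t f^*`. -/
def rearrStar {α : Type*} [MeasurableSpace α] (μ : Measure α) (f : α → ℝ) (t : ℝ) : ℝ≥0∞ :=
  (ENNReal.ofReal t)⁻¹ * ∫⁻ s in Set.Ioo (0:ℝ) t, rearrR μ f s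

/-- `(∫_I g(t)^q dt/t)^{1/q}`, with the usual sup modification when `q = ∞`. -/
def qnorm (q : ℝ≥0∞) (I : Set ℝ) (g : ℝ → ℝ≥0∞) : ℝ≥0∞ :=
  if q = ∞ then ⨆ t ∈ I, g t
  else (∫⁻ t in I, g t ^ q.toReal / ENNReal.ofReal t) ^ (1 / q.toReal)

/-- `∫_I g(t)^q dt/t` (no outer power), with the sup modification when `q = ∞`. -/
def qint (q : ℝ≥0∞) (I : Set ℝ) (g : ℝ → ℝ≥0∞) : ℝ≥0∞ :=
  if q = ∞ then ⨆ t ∈ I, g t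
  else ∫⁻ t in I, g t ^ q.toReal / ENNReal.ofReal t

/-- Lorentz quasinorm `(∫_I (t^{1/p} f^*(t))^q dt/t)^{1/q}`. -/
def lorentz {α : Type*} [MeasurableSpace α] (μ : Measure α) (f : α → ℝ)
    (p : ℝ) (q : ℝ≥0∞) (I : Set ℝ) : ℝ≥0∞ :=
  qnorm q I (fun t => ENNReal.ofReal (t ^ (1 / p)) * rearrR μ f t)

/-- The cube with lower-left corner `a` and side length `l`. -/
def cubeSet {d : ℕ} (a : Fin d → ℝ) (l : ℝ) : Set (Euc d) :=
  {x | ∀ i, a i ≤ x i ∧ x i ≤ a i + l}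

/-- Cubes in `ℝ^d` with sides parallel to the coordinate axes. -/
def IsCube {d : ℕ} (Q : Set (Euc d)) : Prop := ∃ a l, 0 < l ∧ Q = cubeSet a l

/-- The sharp maximal function `f^{#}` on `ℝ^d`. -/
def sharp {d : ℕ} (f : Euc d → ℝ) (x : Euc d) : ℝ≥0∞ :=
  ⨆ Q ∈ {Q : Set (Euc d) | IsCube Q ∧ x ∈ Q},
    ENNReal.ofReal (⨍ y in Q, |f y - ⨍ z in Q, f z|)

/-- The local sharp maximal function `f^{#}_{Q_0;μ}`. -/
def sharpLocal {d : ℕ} (μ : Measure (Euc d)) (Q0 : Set (Euc d)) (f : Euc d → ℝ)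
    (x : Euc d) : ℝ≥0∞ :=
  ⨆ Q ∈ {Q : Set (Euc d) | IsCube Q ∧ x ∈ Q ∧ Q ⊆ Q0},
    ENNReal.ofReal (⨍ y in Q, |f y - ⨍ z in Q, f z ∂μ| ∂μ)

def diffOp {d : ℕ} (h : Euc d) (f : Euc d → ℝ) : Euc d → ℝ := fun x => f (x + h) - f x

/-- The iterated difference `Δ_h^k f`. -/
def iterDiff {d : ℕ} (k : ℕ) (h : Euc d) (f : Euc d → ℝ) : Euc d → ℝ := (diffOp h)^[k] f

/-- The modulus of smoothness `ω_k(f,t)_{p,q}` on `ℝ^d`. -/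
def modulus {d : ℕ} (k : ℕ) (f : Euc d → ℝ) (p : ℝ) (q : ℝ≥0∞) (t : ℝ) : ℝ≥0∞ :=
  ⨆ h ∈ {h : Euc d | ‖h‖ ≤ t}, lorentz volume (iterDiff k h f) p q (Set.Ioi 0)


/-- The modulus of smoothness `ω_k(f,t)_1` in `L_1(ℝ^d)`. -/
def modulusL1 {d : ℕ} (k : ℕ) (f : Euc d → ℝ) (t : ℝ) : ℝ≥0∞ :=
  ⨆ h ∈ {h : Euc d | ‖h‖ ≤ t}, ∫⁻ x, ENNReal.ofReal |iterDiff k h f x|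


/-! ### Part 1: a discrete Sobolev inequality -/

lemma aux_real_step (a : ℝ) (ha0 : 0 ≤ a) (ha1 : a < 1) (M : ℕ) :
    1 / (1 - a) * (M : ℝ) ^ (1 - a) + ((M : ℝ) + 1) ^ (-a)
      ≤ 1 / (1 - a) * ((M : ℝ) + 1) ^ (1 - a) := by
  have h1 : 0 < 1 - a := by linarith
  have hM : (0 : ℝ) < (M : ℝ) + 1 := by positivity
  have hb := rpow_one_add_le_one_add_mul_self (s := -1 / ((M : ℝ) + 1))
    (by rw [le_div_iff₀ hM]; linarith [(Nat.cast_nonneg M : (0 : ℝ) ≤ M)])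
    (p := 1 - a) h1.le (by linarith)
  have e1 : (M : ℝ) = ((M : ℝ) + 1) * (1 + -1 / ((M : ℝ) + 1)) := by field_simp; ring
  have h0 : 0 ≤ 1 + -1 / ((M : ℝ) + 1) := by
    have : 1 + -1 / ((M : ℝ) + 1) = M / ((M : ℝ) + 1) := by field_simp; ring
    rw [this]; positivity
  have e2 : (M : ℝ) ^ (1 - a) = ((M : ℝ) + 1) ^ (1 - a) * (1 + -1 / ((M : ℝ) + 1)) ^ (1 - a) := by
    conv_lhs => rw [e1]
    rw [Real.mul_rpow hM.le h0]
  have e3 : ((M : ℝ) + 1) ^ (1 - a) = ((M : ℝ) + 1) ^ (-a) * ((M : ℝ) + 1) := by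
    rw [show 1 - a = -a + 1 by ring, Real.rpow_add hM, Real.rpow_one]
  have hp : 0 < ((M : ℝ) + 1) ^ (-a) := Real.rpow_pos_of_pos hM _
  have e4 : (M : ℝ) ^ (1 - a) ≤
      ((M : ℝ) + 1) ^ (1 - a) * (1 + (1 - a) * (-1 / ((M : ℝ) + 1))) := by
    rw [e2]
    exact mul_le_mul_of_nonneg_left hb (Real.rpow_nonneg hM.le _)
  have e5 : ((M : ℝ) + 1) ^ (1 - a) * (1 + (1 - a) * (-1 / ((M : ℝ) + 1)))
      = ((M : ℝ) + 1) ^ (1 - a) - (1 - a) * ((M : ℝ) + 1) ^ (-a) := by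
    rw [e3]; field_simp; ring
  rw [e5] at e4
  have e6 : 1 / (1 - a) * (M : ℝ) ^ (1 - a) ≤
    1 / (1 - a) * (((M : ℝ) + 1) ^ (1 - a) - (1 - a) * ((M : ℝ) + 1) ^ (-a)) :=
    mul_le_mul_of_nonneg_left e4 (by positivity)
  have e7 : 1 / (1 - a) * (((M : ℝ) + 1) ^ (1 - a) - (1 - a) * ((M : ℝ) + 1) ^ (-a))
    = 1 / (1 - a) * ((M : ℝ) + 1) ^ (1 - a) - ((M : ℝ) + 1) ^ (-a) := by field_simp
  linarith

lemma ennreal_rpow_anti {a : ℝ} (ha : 0 ≤ a) {x y : ℝ≥0∞} (h : x ≤ y) :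
    y ^ (-a) ≤ x ^ (-a) := by
  rw [ENNReal.rpow_neg, ENNReal.rpow_neg, ENNReal.inv_le_inv]
  exact ENNReal.rpow_le_rpow h ha

lemma sum_rpow_le {ι : Type*} (a : ℝ) (ha0 : 0 ≤ a) (ha1 : a < 1) (N : ι → ℝ≥0∞)
    (hN : ∀ T : Finset ι, T.Nonempty → ∃ n ∈ T, (T.card : ℝ≥0∞) ≤ N n) (S : Finset ι) :
    ∑ n ∈ S, N n ^ (-a) ≤ ENNReal.ofReal (1 / (1 - a)) * (S.card : ℝ≥0∞) ^ (1 - a) := by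
  classical
  have h1 : 0 < 1 - a := by linarith
  induction hM : S.card generalizing S with
  | zero =>
    rw [Finset.card_eq_zero] at hM
    subst hM; simp
  | succ M ih =>
    obtain ⟨n, hn, hc⟩ := hN S (Finset.card_pos.mp (by omega))
    have hc' : (S.erase n).card = M := by rw [Finset.card_erase_of_mem hn]; omega
    rw [← Finset.sum_erase_add _ _ hn]
    have hi := ih _ hc'
    have h2 : N n ^ (-a) ≤ ENNReal.ofReal (((M : ℝ) + 1) ^ (-a)) := by
      rw [← ENNReal.ofReal_rpow_of_pos (by positivity)]
      apply ennreal_rpow_anti ha0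
      rw [hM] at hc
      refine le_trans (le_of_eq ?_) hc
      rw [ENNReal.ofReal_add (by positivity) (by positivity)]
      simp
    refine (add_le_add hi h2).trans ?_
    have c1 : ((M : ℕ) : ℝ≥0∞) ^ (1 - a) = ENNReal.ofReal ((M : ℝ) ^ (1 - a)) := by
      rw [← ENNReal.ofReal_rpow_of_nonneg (by positivity) h1.le]; simp
    have c2 : ((M + 1 : ℕ) : ℝ≥0∞) ^ (1 - a) = ENNReal.ofReal (((M : ℝ) + 1) ^ (1 - a)) := by
      rw [← ENNReal.ofReal_rpow_of_nonneg (by positivity) h1.le,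
        ENNReal.ofReal_add (by positivity) (by positivity)]; simp
    rw [c1, c2, ← ENNReal.ofReal_mul (by positivity), ← ENNReal.ofReal_mul (by positivity),
      ← ENNReal.ofReal_add (by positivity) (by positivity)]
    exact ENNReal.ofReal_le_ofReal (aux_real_step a ha0 ha1 M)

lemma lintegral_pi_count {d : ℕ} (g : (Fin d → ℤ) → ℝ≥0∞) :
    ∫⁻ x, g x ∂(Measure.pi fun _ : Fin d => (Measure.count : Measure ℤ)) = ∑' x, g x := by
  rw [lintegral_countable']
  congr 1; ext x
  rw [Measure.pi_singleton]
  simp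

open Classical in
lemma isoperim {d : ℕ} (hd : 2 ≤ d) (E : Finset (Fin d → ℤ)) :
    (E.card : ℝ≥0∞) ^ (1 - 1 / (d : ℝ)) ≤
      ∑ i : Fin d, ∑' n : Fin d → ℤ,
        if (n ∈ E) ↔ (n + Pi.single i 1 ∈ E) then (0 : ℝ≥0∞) else 1 := by
  set g : (Fin d → ℤ) → ℝ≥0∞ := fun n => ∑ i : Fin d,
    if (n ∈ E) ↔ (n + Pi.single i 1 ∈ E) then (0 : ℝ≥0∞) else 1 with hg
  have hd' : (2 : ℝ) ≤ d := by exact_mod_cast hd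
  have hp : Real.HolderConjugate (Fintype.card (Fin d)) ((d : ℝ) / (d - 1)) := by
    rw [Fintype.card_fin, Real.holderConjugate_iff]
    refine ⟨by linarith, ?_⟩
    have : (d : ℝ) - 1 ≠ 0 := by linarith
    field_simp; ring
  have key := lintegral_prod_lintegral_pow_le (fun _ : Fin d => (Measure.count : Measure ℤ)) hp
    (f := g) (measurable_of_countable g)
  rw [lintegral_pi_count, lintegral_pi_count] at key
  have hline : ∀ x ∈ E, ∀ i : Fin d,
      1 ≤ ∫⁻ y, g (Function.update x i y) ∂(Measure.count : Measure ℤ) := by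
    intro x hx i
    rw [lintegral_count]
    set T : Finset ℤ := (E.image (fun z => z i)).filter (fun y => Function.update x i y ∈ E) with hT
    have hxT : x i ∈ T := by
      simp only [hT, Finset.mem_filter, Finset.mem_image, Function.update_eq_self]
      exact ⟨⟨x, hx, rfl⟩, hx⟩
    have hne : T.Nonempty := ⟨_, hxT⟩
    have hy1 : Function.update x i (T.max' hne) ∈ E := (Finset.mem_filter.mp (T.max'_mem hne)).2
    have hy2 : Function.update x i (T.max' hne + 1) ∉ E := by
      intro hmem
      have : T.max' hne + 1 ∈ T :=
        Finset.mem_filter.mpr ⟨Finset.mem_image.mpr ⟨_, hmem, by simp⟩, hmem⟩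
      have := T.le_max' _ this
      omega
    refine le_trans ?_ (ENNReal.le_tsum (T.max' hne))
    rw [hg]
    refine le_trans ?_ (Finset.single_le_sum (fun _ _ => zero_le) (Finset.mem_univ i))
    have : Function.update x i (T.max' hne) + Pi.single i 1 = Function.update x i (T.max' hne + 1) := by
      ext j
      by_cases hj : j = i
      · subst hj; simp
      · simp [hj]
    rw [this]
    simp [hy1, hy2]
  have hlow : (E.card : ℝ≥0∞) ≤ ∑' x : Fin d → ℤ, ∏ i, (∫⁻ y, g (Function.update x i y)
      ∂(Measure.count : Measure ℤ)) ^ ((1 : ℝ) / ((Fintype.card (Fin d) : ℝ) - 1)) := by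
    refine le_trans ?_ (ENNReal.sum_le_tsum E)
    have : (E.card : ℝ≥0∞) = ∑ x ∈ E, 1 := by simp
    rw [this]
    refine Finset.sum_le_sum fun x hx => ?_
    refine Finset.one_le_prod' fun i _ => ?_
    refine ENNReal.one_le_rpow (hline x hx i) ?_
    rw [Fintype.card_fin]
    apply div_pos one_pos; linarith
  have h2 := hlow.trans key
  have h3 := ENNReal.rpow_le_rpow h2 (z := 1 - 1 / (d : ℝ)) (by
    rw [sub_nonneg, div_le_one (by linarith)]; linarith)
  rw [← ENNReal.rpow_mul] at h3
  have e : (d : ℝ) / (d - 1) * (1 - 1 / d) = 1 := by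
    have : (d : ℝ) - 1 ≠ 0 := by linarith
    field_simp
  rw [e, ENNReal.rpow_one, hg, Summable.tsum_finsetSum (fun _ _ => ENNReal.summable)] at h3
  exact h3

/-- Unit difference on the lattice. -/
def latDiff {d : ℕ} (i : Fin d) (F : (Fin d → ℤ) → ℝ) : (Fin d → ℤ) → ℝ :=
  fun n => F (n + Pi.single i 1) - F n

/-- Sum of the `ℓ¹` norms of all mixed differences of order `j`. -/
def latNorm {d : ℕ} : ℕ → ((Fin d → ℤ) → ℝ) → ℝ≥0∞
  | 0, F => ∑' n, ENNReal.ofReal |F n|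
  | j + 1, F => ∑ i : Fin d, latNorm j (latDiff i F)

/-- The rank of the value of `F` at `n`. -/
def rankN {ι : Type*} (F : ι → ℝ) (n : ι) : ℝ≥0∞ :=
  (({m | |F n| ≤ |F m|} : Set ι).encard : ℝ≥0∞)

lemma rankN_spec {ι : Type*} (F : ι → ℝ) (T : Finset ι) (hT : T.Nonempty) :
    ∃ n ∈ T, (T.card : ℝ≥0∞) ≤ rankN F n := by
  obtain ⟨n, hn, hmin⟩ := T.exists_min_image (fun n => |F n|) hT
  refine ⟨n, hn, ?_⟩
  unfold rankN
  have : (T : Set ι).encard ≤ ({m | |F n| ≤ |F m|} : Set ι).encard :=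
    Set.encard_le_encard (fun m hm => hmin m hm)
  rw [Set.encard_coe_eq_coe_finsetCard] at this
  exact_mod_cast this

lemma lattice_step {d : ℕ} (hd : 2 ≤ d) (F : (Fin d → ℤ) → ℝ) (hF : ∑' n, ENNReal.ofReal |F n| ≠ ∞)
    (A : ℝ≥0∞) (a : ℝ) (ha : 0 ≤ a) (V : (Fin d → ℤ) → ℝ≥0∞)
    (hV : ∀ S : Finset (Fin d → ℤ), ∑ n ∈ S, V n ≤ A * (S.card : ℝ≥0∞) ^ (1 - 1 / (d : ℝ) - a)) :
    ∑' n, ENNReal.ofReal |F n| * V n ≤ A * ∑ i : Fin d, ∑' n, ENNReal.ofReal |latDiff i F n| *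
      (rankN F n ^ (-a) + rankN F (n + Pi.single i 1) ^ (-a)) := by
  classical
  have hfin : ∀ l : ℝ, 0 < l → {n | l < |F n|}.Finite := by
    intro l hl
    have h := ENNReal.finite_const_le_of_tsum_ne_top hF (ε := ENNReal.ofReal l) (by simpa using hl)
    exact h.subset fun n hn => ENNReal.ofReal_le_ofReal (le_of_lt hn)
  set W : Fin d → (Fin d → ℤ) → ℝ≥0∞ := fun i n =>
    rankN F n ^ (-a) + rankN F (n + Pi.single i 1) ^ (-a) with hW
  have hlev : ∀ l : ℝ, 0 < l → ∑' n, (Set.Iio |F n|).indicator (fun _ => V n) l ≤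
      A * ∑ i : Fin d, ∑' n, (Set.Ico (min |F n| |F (n + Pi.single i 1)|)
        (max |F n| |F (n + Pi.single i 1)|)).indicator (fun _ => W i n) l := by
    intro l hl
    set E := (hfin l hl).toFinset with hE
    have hmem : ∀ n, n ∈ E ↔ l < |F n| := fun n => by simp [hE]
    have e1 : ∑' n, (Set.Iio |F n|).indicator (fun _ => V n) l = ∑ n ∈ E, V n := by
      rw [tsum_eq_sum (s := E)]
      · refine Finset.sum_congr rfl fun n hn => ?_
        rw [Set.indicator_of_mem]; exact (hmem n).mp hn
      · intro n hn
        rw [Set.indicator_of_notMem]; exact fun h => hn ((hmem n).mpr h)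
    rw [e1]
    rcases E.eq_empty_or_nonempty with h0 | h0
    · rw [h0]; simp
    refine (hV E).trans (mul_le_mul_right ?_ A)
    have hc0 : (E.card : ℝ≥0∞) ≠ 0 := by
      simpa using h0.ne_empty
    rw [show 1 - 1 / (d : ℝ) - a = (1 - 1 / (d : ℝ)) + -a by ring,
      ENNReal.rpow_add _ _ hc0 (by simp)]
    refine (mul_le_mul_left (isoperim hd E) _).trans ?_
    rw [Finset.sum_mul]
    refine Finset.sum_le_sum fun i _ => ?_
    rw [← ENNReal.tsum_mul_right]
    refine ENNReal.tsum_le_tsum fun n => ?_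
    have hr : ∀ m, m ∈ E → (E.card : ℝ≥0∞) ^ (-a) ≤ rankN F m ^ (-a) := by
      intro m hm
      apply ennreal_rpow_anti ha
      unfold rankN
      have : ({p | |F m| ≤ |F p|} : Set _).encard ≤ (E : Set (Fin d → ℤ)).encard :=
        Set.encard_le_encard (fun p hp => by
          simp only [Finset.mem_coe, hmem] at hm ⊢
          exact lt_of_lt_of_le hm hp)
      rw [Set.encard_coe_eq_coe_finsetCard] at this
      exact_mod_cast this
    by_cases h1 : n ∈ E <;> by_cases h2 : n + Pi.single i 1 ∈ E
    · simp [h1, h2]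
    · rw [Set.indicator_of_mem]
      · simp only [h1, h2, iff_false, not_true_eq_false, if_false, one_mul]
        exact (hr _ h1).trans le_self_add
      · rw [hmem] at h1 h2
        exact ⟨min_le_of_right_le (not_lt.mp h2), lt_max_of_lt_left h1⟩
    · rw [Set.indicator_of_mem]
      · simp only [h1, h2, iff_true, if_false, one_mul]
        exact (hr _ h2).trans le_add_self
      · rw [hmem] at h1 h2
        exact ⟨min_le_of_left_le (not_lt.mp h1), lt_max_of_lt_right h2⟩
    · simp [h1, h2]
  have hL : ∑' n, ENNReal.ofReal |F n| * V n =
      ∫⁻ l in Set.Ioi (0 : ℝ), ∑' n, (Set.Iio |F n|).indicator (fun _ => V n) l := by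
    rw [lintegral_tsum (fun n => (measurable_const.indicator measurableSet_Iio).aemeasurable)]
    congr 1; ext n
    rw [lintegral_indicator measurableSet_Iio, Measure.restrict_restrict measurableSet_Iio,
      setLIntegral_const, Set.inter_comm, Set.Ioi_inter_Iio, Real.volume_Ioo, sub_zero, mul_comm]
  rw [hL]
  refine (setLIntegral_mono' measurableSet_Ioi hlev).trans ?_
  have hm : ∀ i n, Measurable fun l => (Set.Ico (min |F n| |F (n + Pi.single i 1)|)
        (max |F n| |F (n + Pi.single i 1)|)).indicator (fun _ => W i n) l := fun i n =>
    measurable_const.indicator measurableSet_Ico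
  rw [lintegral_const_mul _ (Finset.measurable_sum _ fun i _ => Measurable.tsum (hm i))]
  refine mul_le_mul_right ?_ A
  rw [lintegral_finsetSum _ fun i _ => Measurable.tsum (hm i)]
  refine Finset.sum_le_sum fun i _ => ?_
  rw [lintegral_tsum fun n => (hm i n).aemeasurable]
  refine ENNReal.tsum_le_tsum fun n => ?_
  refine (setLIntegral_le_lintegral _ _).trans ?_
  rw [lintegral_indicator measurableSet_Ico, setLIntegral_const, Real.volume_Ico, mul_comm,
    max_sub_min_eq_abs]
  refine mul_le_mul_left (ENNReal.ofReal_le_ofReal ?_) _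
  exact abs_abs_sub_abs_le_abs_sub _ _

lemma lattice_sobolev {d : ℕ} (hd : 2 ≤ d) (j : ℕ) (hj : j ≤ d) :
    ∃ C : ℝ≥0∞, C ≠ ∞ ∧ ∀ (F : (Fin d → ℤ) → ℝ) (_ : ∑' n, ENNReal.ofReal |F n| ≠ ∞)
      (V : (Fin d → ℤ) → ℝ≥0∞) (A : ℝ≥0∞) (_ : ∀ S : Finset (Fin d → ℤ),
        ∑ n ∈ S, V n ≤ A * (S.card : ℝ≥0∞) ^ (1 - (j : ℝ) / (d : ℝ))),
      ∑' n, ENNReal.ofReal |F n| * V n ≤ C * A * latNorm j F := by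
  have hd0 : (0 : ℝ) < d := by exact_mod_cast (by omega : 0 < d)
  induction j with
  | zero =>
    refine ⟨1, by simp, fun F hF V A hV => ?_⟩
    have : ∀ n, V n ≤ A := fun n => by simpa using hV {n}
    rw [one_mul, latNorm, ← ENNReal.tsum_mul_left]
    refine ENNReal.tsum_le_tsum fun n => ?_
    rw [mul_comm]
    exact mul_le_mul_left (this n) _
  | succ j ih =>
    obtain ⟨C, hC, h⟩ := ih (by omega)
    set a : ℝ := (j : ℝ) / d with ha
    have ha0 : 0 ≤ a := by positivity
    have ha1 : a < 1 := by
      rw [ha, div_lt_one hd0]; exact_mod_cast hj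
    refine ⟨C * (2 * ENNReal.ofReal (1 / (1 - a))),
      ENNReal.mul_ne_top hC (ENNReal.mul_ne_top (by simp) (by simp)), fun F hF V A hV => ?_⟩
    have hV' : ∀ S : Finset (Fin d → ℤ),
        ∑ n ∈ S, V n ≤ A * (S.card : ℝ≥0∞) ^ (1 - 1 / (d : ℝ) - a) := by
      intro S
      convert hV S using 3
      rw [ha]; push_cast; ring
    refine (lattice_step hd F hF A a ha0 V hV').trans ?_
    rw [latNorm]
    calc A * ∑ i : Fin d, ∑' n, ENNReal.ofReal |latDiff i F n| *
      (rankN F n ^ (-a) + rankN F (n + Pi.single i 1) ^ (-a))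
        ≤ A * ∑ i : Fin d, C * (2 * ENNReal.ofReal (1 / (1 - a))) * latNorm j (latDiff i F) := by
          refine mul_le_mul_right (Finset.sum_le_sum fun i _ => ?_) A
          refine h _ ?_ _ _ ?_
          · have hb : ∑' n, ENNReal.ofReal |latDiff i F n| ≤
                ∑' n : Fin d → ℤ, ENNReal.ofReal |F (n + Pi.single i 1)| + ∑' n, ENNReal.ofReal |F n| := by
              rw [← ENNReal.tsum_add]
              refine ENNReal.tsum_le_tsum fun n => ?_
              rw [← ENNReal.ofReal_add (abs_nonneg _) (abs_nonneg _)]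
              exact ENNReal.ofReal_le_ofReal (abs_sub _ _)
            have hs := (Equiv.addRight (Pi.single i 1 : Fin d → ℤ)).tsum_eq
              (fun n => ENNReal.ofReal |F n|)
            simp only [Equiv.coe_addRight] at hs
            rw [hs] at hb
            exact ne_top_of_le_ne_top (ENNReal.add_ne_top.mpr ⟨hF, hF⟩) hb
          · intro S
            rw [Finset.sum_add_distrib]
            have h1 := sum_rpow_le a ha0 ha1 (rankN F) (rankN_spec F) S
            have h2 := sum_rpow_le a ha0 ha1 (rankN F) (rankN_spec F)
              (S.map (Equiv.addRight (Pi.single i 1 : Fin d → ℤ)).toEmbedding)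
            rw [Finset.sum_map, Finset.card_map] at h2
            refine (add_le_add h1 h2).trans (le_of_eq ?_)
            ring
      _ = _ := by
          rw [← Finset.mul_sum]; ring

/-! ### Part 2: mixed differences -/

/-- Mixed difference with steps `h 0, …, h (k-1)`. -/
def mixDiff {d : ℕ} : ℕ → (ℕ → Euc d) → (Euc d → ℝ) → (Euc d → ℝ)
  | 0, _, f => f
  | k + 1, h, f => mixDiff k h (diffOp (h k) f)

lemma mixDiff_eq_sum {d : ℕ} (k : ℕ) (h : ℕ → Euc d) (f : Euc d → ℝ) (x : Euc d) :
    mixDiff k h f x = ∑ S ∈ (Finset.range k).powerset,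
      (-1 : ℝ) ^ (k + S.card) * f (x + ∑ j ∈ S, h j) := by
  induction k generalizing f with
  | zero => simp [mixDiff]
  | succ k ih =>
    rw [mixDiff, ih, Finset.range_add_one, Finset.sum_powerset_insert Finset.notMem_range_self,
      ← Finset.sum_add_distrib]
    refine Finset.sum_congr rfl fun S hS => ?_
    have hk : k ∉ S := fun hk => Finset.notMem_range_self (Finset.mem_powerset.mp hS hk)
    rw [Finset.card_insert_of_notMem hk, Finset.sum_insert hk, diffOp,
      show x + (h k + ∑ j ∈ S, h j) = x + ∑ j ∈ S, h j + h k by abel]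
    ring

lemma mixDiff_zero {d : ℕ} (k : ℕ) (h : ℕ → Euc d) :
    mixDiff k h (0 : Euc d → ℝ) = 0 := by
  funext x
  rw [mixDiff_eq_sum]; simp

lemma mixDiff_of_zero {d : ℕ} (k : ℕ) (h : ℕ → Euc d) (f : Euc d → ℝ) (j : ℕ) (hj : j < k)
    (h0 : h j = 0) : mixDiff k h f = 0 := by
  induction k generalizing f with
  | zero => omega
  | succ k ih =>
    rw [mixDiff]
    rcases Nat.lt_succ_iff_lt_or_eq.mp hj with hj | hj
    · exact ih _ hj
    · subst hj
      have : diffOp (h j) f = 0 := by funext x; simp [diffOp, h0]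
      rw [this, mixDiff_zero]

lemma iterDiff_eq_sum {d : ℕ} (k : ℕ) (h : Euc d) (f : Euc d → ℝ) (x : Euc d) :
    iterDiff k h f x = ∑ l ∈ Finset.range (k + 1),
      (-1 : ℝ) ^ (k - l) * (k.choose l : ℝ) * f (x + (l : ℝ) • h) := by
  have : diffOp h = fwdDiff h := by
    funext f x; simp [diffOp, fwdDiff]
  rw [iterDiff, this, fwdDiff_iter_eq_sum_shift]
  refine Finset.sum_congr rfl fun l _ => ?_
  rw [Nat.cast_smul_eq_nsmul ℝ l h]
  simp

lemma mixDiff_eq_iterDiff {d : ℕ} (k : ℕ) (h : ℕ → Euc d) (f : Euc d → ℝ) (x : Euc d) :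
    mixDiff k h f x = ∑ S ∈ (Finset.range k).powerset, (-1 : ℝ) ^ S.card *
      iterDiff k (-∑ j ∈ S, (1 / ((j : ℝ) + 1)) • h j) f (x + ∑ j ∈ S, h j) := by
  simp_rw [iterDiff_eq_sum, Finset.mul_sum]
  rw [Finset.sum_comm]
  have key : ∀ l ∈ Finset.range (k + 1), ∑ S ∈ (Finset.range k).powerset,
      (-1 : ℝ) ^ S.card * ((-1 : ℝ) ^ (k - l) * (k.choose l : ℝ) *
        f (x + ∑ j ∈ S, h j + (l : ℝ) • -∑ j ∈ S, (1 / ((j : ℝ) + 1)) • h j)) =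
      (-1 : ℝ) ^ (k - l) * (k.choose l : ℝ) * (-1) ^ k *
        mixDiff k (fun j => (1 - (l : ℝ) / ((j : ℝ) + 1)) • h j) f x := by
    intro l _
    rw [mixDiff_eq_sum, Finset.mul_sum]
    refine Finset.sum_congr rfl fun S _ => ?_
    have e : x + ∑ j ∈ S, h j + (l : ℝ) • -∑ j ∈ S, (1 / ((j : ℝ) + 1)) • h j =
        x + ∑ j ∈ S, (1 - (l : ℝ) / ((j : ℝ) + 1)) • h j := by
      rw [add_assoc, smul_neg, Finset.smul_sum, ← sub_eq_add_neg, ← Finset.sum_sub_distrib]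
      congr 1
      refine Finset.sum_congr rfl fun j _ => ?_
      rw [sub_smul, one_smul, smul_smul, mul_one_div]
    rw [e, pow_add]
    have : ((-1 : ℝ) ^ k) * (-1) ^ k = 1 := by rw [← mul_pow]; simp
    linear_combination (-((-1 : ℝ) ^ S.card * (-1) ^ (k - l) * (k.choose l : ℝ) *
      f (x + ∑ j ∈ S, (1 - (l : ℝ) / ((j : ℝ) + 1)) • h j))) * this
  rw [Finset.sum_congr rfl key, Finset.sum_eq_single 0]
  · have : ((-1 : ℝ) ^ k) * (-1) ^ k = 1 := by rw [← mul_pow]; simp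
    simp [this]
  · intro l hl hl0
    have : l - 1 < k := by have := Finset.mem_range.mp hl; omega
    rw [mixDiff_of_zero k _ f (l - 1) this]
    · simp
    · have : ((l - 1 : ℕ) : ℝ) + 1 = l := by
        rw [Nat.cast_sub (by omega)]; simp
      rw [this, div_self (by exact_mod_cast hl0)]
      simp
  · simp

lemma iterDiff_measurable {d : ℕ} (k : ℕ) (h : Euc d) (f : Euc d → ℝ) (hf : Measurable f) :
    Measurable (iterDiff k h f) := by
  have : iterDiff k h f = fun x => ∑ l ∈ Finset.range (k + 1),
      (-1 : ℝ) ^ (k - l) * (k.choose l : ℝ) * f (x + (l : ℝ) • h) := by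
    funext x; exact iterDiff_eq_sum k h f x
  rw [this]
  fun_prop

lemma mixDiff_norm_le {d : ℕ} (k : ℕ) (h : ℕ → Euc d) (f : Euc d → ℝ) (hf : Measurable f)
    (t : ℝ) (ht : ∀ S ⊆ Finset.range k, ∑ j ∈ S, ‖h j‖ ≤ t) :
    ∫⁻ x, ENNReal.ofReal |mixDiff k h f x| ≤ 2 ^ k * modulusL1 k f t := by
  have h1 : ∀ x, ENNReal.ofReal |mixDiff k h f x| ≤ ∑ S ∈ (Finset.range k).powerset,
      ENNReal.ofReal |iterDiff k (-∑ j ∈ S, (1 / ((j : ℝ) + 1)) • h j) f (x + ∑ j ∈ S, h j)| := by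
    intro x
    rw [mixDiff_eq_iterDiff, ← ENNReal.ofReal_sum_of_nonneg (fun _ _ => abs_nonneg _)]
    refine ENNReal.ofReal_le_ofReal ((Finset.abs_sum_le_sum_abs _ _).trans (le_of_eq ?_))
    refine Finset.sum_congr rfl fun S _ => ?_
    rw [abs_mul]; simp
  refine (lintegral_mono h1).trans ?_
  rw [lintegral_finsetSum]
  · have : (2 ^ k * modulusL1 k f t : ℝ≥0∞) =
        ∑ S ∈ (Finset.range k).powerset, modulusL1 k f t := by
      simp
    rw [this]
    refine Finset.sum_le_sum fun S hS => ?_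
    rw [lintegral_add_right_eq_self (fun x => ENNReal.ofReal
      |iterDiff k (-∑ j ∈ S, (1 / ((j : ℝ) + 1)) • h j) f x|)]
    unfold modulusL1
    refine le_iSup₂_of_le (-∑ j ∈ S, (1 / ((j : ℝ) + 1)) • h j) ?_ le_rfl
    simp only [Set.mem_ofPred_eq, norm_neg]
    refine (norm_sum_le _ _).trans (le_trans (Finset.sum_le_sum fun j _ => ?_)
      (ht S (Finset.mem_powerset.mp hS)))
    rw [norm_smul]
    have : ‖1 / ((j : ℝ) + 1)‖ ≤ 1 := by
      rw [Real.norm_of_nonneg (by positivity), div_le_one (by positivity)]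
      linarith [(Nat.cast_nonneg j : (0 : ℝ) ≤ j)]
    exact mul_le_of_le_one_left (norm_nonneg _) this
  · intro S _
    have := iterDiff_measurable k (-∑ j ∈ S, (1 / ((j : ℝ) + 1)) • h j) f hf
    fun_prop

/-- Coordinate vector of length `τ`. -/
def stepV {d : ℕ} (τ : ℝ) (i : Fin d) : Euc d := EuclideanSpace.single i τ

/-- Sum of the `L¹` norms of all mixed differences of order `j` and step `τ`. -/
def contNorm {d : ℕ} (τ : ℝ) : ℕ → (Euc d → ℝ) → ℝ≥0∞
  | 0, f => ∫⁻ x, ENNReal.ofReal |f x|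
  | j + 1, f => ∑ i : Fin d, contNorm τ j (diffOp (stepV τ i) f)

lemma mixDiff_congr {d : ℕ} (k : ℕ) (h h' : ℕ → Euc d) (f : Euc d → ℝ)
    (hh : ∀ m < k, h m = h' m) : mixDiff k h f = mixDiff k h' f := by
  induction k generalizing f with
  | zero => rfl
  | succ k ih =>
    rw [mixDiff, mixDiff, hh k (by omega), ih _ fun m hm => hh m (by omega)]

lemma contNorm_le {d : ℕ} (hd : 0 < d) (τ : ℝ) (j : ℕ) (f : Euc d → ℝ) (B : ℝ≥0∞)
    (hB : ∀ s : ℕ → Fin d, ∫⁻ x, ENNReal.ofReal |mixDiff j (fun m => stepV τ (s m)) f x| ≤ B) :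
    contNorm τ j f ≤ (d : ℝ≥0∞) ^ j * B := by
  induction j generalizing f with
  | zero => simpa [contNorm, mixDiff] using hB (fun _ => ⟨0, hd⟩)
  | succ j ih =>
    rw [contNorm]
    have : ∀ i ∈ (Finset.univ : Finset (Fin d)),
        contNorm τ j (diffOp (stepV τ i) f) ≤ (d : ℝ≥0∞) ^ j * B := by
      intro i _
      refine ih _ fun s => ?_
      have := hB (Function.update s j i)
      rw [mixDiff] at this
      simp only [Function.update_self] at this
      rw [mixDiff_congr j _ (fun m => stepV τ (s m))] at this
      · exact this
      · intro m hm
        rw [Function.update_of_ne (by omega)]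
    refine (Finset.sum_le_sum this).trans (le_of_eq ?_)
    simp
    ring

/-! ### Part 3: slicing into lattices -/

/-- Half-open cube. -/
def hcube (d : ℕ) (r : ℝ) : Set (Euc d) := {x | ∀ i, 0 ≤ x i ∧ x i < r}

/-- Lattice points. -/
def latPt {d : ℕ} (τ : ℝ) (n : Fin d → ℤ) : Euc d := WithLp.toLp 2 fun i => τ * (n i : ℝ)

lemma latPt_apply {d : ℕ} (τ : ℝ) (n : Fin d → ℤ) (i : Fin d) : latPt τ n i = τ * n i := rfl

lemma latPt_add {d : ℕ} (τ : ℝ) (n : Fin d → ℤ) (i : Fin d) :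
    latPt τ (n + Pi.single i 1) = latPt τ n + stepV τ i := by
  ext j
  simp only [latPt_apply, stepV, PiLp.add_apply, Pi.add_apply]
  by_cases h : j = i
  · subst h; simp; ring
  · simp [h]

lemma measurableSet_hcube (d : ℕ) (r : ℝ) : MeasurableSet (hcube d r) := by
  unfold hcube
  have : {x : Euc d | ∀ i, 0 ≤ x i ∧ x i < r} = ⋂ i, {x : Euc d | 0 ≤ x i ∧ x i < r} := by
    ext x; simp
  rw [this]
  refine MeasurableSet.iInter fun i => ?_
  have hm : Measurable fun x : Euc d => x i := by fun_prop
  exact (hm measurableSet_Ico : MeasurableSet ((fun x : Euc d => x i) ⁻¹' Set.Ico 0 r))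

lemma volume_hcube (d : ℕ) (r : ℝ) : volume (hcube d r) = ENNReal.ofReal r ^ d := by
  have h := (EuclideanSpace.volume_preserving_symm_measurableEquiv_toLp (Fin d)).measure_preimage
    (s := Set.pi Set.univ fun _ => Set.Ico 0 r) (by
      exact (MeasurableSet.univ_pi fun _ => measurableSet_Ico).nullMeasurableSet)
  have e : hcube d r = (MeasurableEquiv.toLp 2 (Fin d → ℝ)).symm ⁻¹'
      (Set.pi Set.univ fun _ => Set.Ico 0 r) := by
    ext x; simp [hcube]
  rw [e, h, Real.volume_pi_Ico]
  simp

lemma tsum_hcube {d : ℕ} {τ : ℝ} (hτ : 0 < τ) (x : Euc d) :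
    ∑' n : Fin d → ℤ, (hcube d τ).indicator (fun _ => (1 : ℝ≥0∞)) (x - latPt τ n) = 1 := by
  have hiff : ∀ n : Fin d → ℤ, x - latPt τ n ∈ hcube d τ ↔ n = fun i => ⌊x i / τ⌋ := by
    intro n
    simp only [hcube, Set.mem_ofPred_eq, PiLp.sub_apply, latPt_apply, funext_iff]
    refine forall_congr' fun i => ?_
    rw [eq_comm, Int.floor_eq_iff, le_div_iff₀ hτ, div_lt_iff₀ hτ]
    constructor
    · rintro ⟨h1, h2⟩; constructor <;> linarith
    · rintro ⟨h1, h2⟩; constructor <;> linarith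
  rw [tsum_eq_single (fun i => ⌊x i / τ⌋)]
  · rw [Set.indicator_of_mem ((hiff _).mpr rfl)]
  · intro n hn
    rw [Set.indicator_of_notMem (fun h => hn ((hiff _).mp h))]

lemma slice {d : ℕ} {τ : ℝ} (hτ : 0 < τ) (g : Euc d → ℝ≥0∞) (hg : Measurable g) :
    ∫⁻ x, g x = ∫⁻ x in hcube d τ, ∑' n : Fin d → ℤ, g (x + latPt τ n) := by
  have hi : Measurable ((hcube d τ).indicator fun _ : Euc d => (1 : ℝ≥0∞)) :=
    measurable_const.indicator (measurableSet_hcube d τ)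
  calc ∫⁻ x, g x = ∫⁻ x, ∑' n : Fin d → ℤ,
        g x * (hcube d τ).indicator (fun _ => (1 : ℝ≥0∞)) (x - latPt τ n) := by
        congr 1; ext x
        rw [ENNReal.tsum_mul_left, tsum_hcube hτ, mul_one]
    _ = ∑' n : Fin d → ℤ, ∫⁻ x, g x * (hcube d τ).indicator (fun _ => (1 : ℝ≥0∞)) (x - latPt τ n) := by
        rw [lintegral_tsum]
        intro n
        fun_prop
    _ = ∑' n : Fin d → ℤ, ∫⁻ x, g (x + latPt τ n) * (hcube d τ).indicator (fun _ => (1 : ℝ≥0∞)) x := by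
        congr 1; ext n
        rw [← lintegral_add_right_eq_self _ (latPt τ n)]
        simp
    _ = ∑' n : Fin d → ℤ, ∫⁻ x in hcube d τ, g (x + latPt τ n) := by
        congr 1; ext n
        rw [← lintegral_indicator (measurableSet_hcube d τ)]
        congr 1; ext x
        by_cases hx : x ∈ hcube d τ <;> simp [hx]
    _ = _ := by
        rw [lintegral_tsum]
        intro n
        fun_prop

lemma diffOp_measurable {d : ℕ} (h : Euc d) (f : Euc d → ℝ) (hf : Measurable f) :
    Measurable (diffOp h f) := by
  unfold diffOp; fun_prop

lemma latDiff_slice {d : ℕ} (τ : ℝ) (f : Euc d → ℝ) (i : Fin d) (x : Euc d) :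
    latDiff i (fun n => f (x + latPt τ n)) = fun n => diffOp (stepV τ i) f (x + latPt τ n) := by
  funext n
  simp [latDiff, diffOp, latPt_add, add_assoc]

lemma latNorm_measurable {d : ℕ} (τ : ℝ) (j : ℕ) (f : Euc d → ℝ) (hf : Measurable f) :
    Measurable fun x => latNorm j (fun n => f (x + latPt τ n)) := by
  induction j generalizing f with
  | zero =>
    simp only [latNorm]
    refine Measurable.tsum fun n => ?_
    fun_prop
  | succ j ih =>
    simp only [latNorm, latDiff_slice]
    exact Finset.measurable_sum _ fun i _ => ih _ (diffOp_measurable _ _ hf)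

lemma latNorm_integral {d : ℕ} {τ : ℝ} (hτ : 0 < τ) (j : ℕ) (f : Euc d → ℝ) (hf : Measurable f) :
    ∫⁻ x in hcube d τ, latNorm j (fun n => f (x + latPt τ n)) = contNorm τ j f := by
  induction j generalizing f with
  | zero =>
    simp only [latNorm, contNorm]
    rw [slice hτ (fun x => ENNReal.ofReal |f x|) (by fun_prop)]
  | succ j ih =>
    simp only [latNorm, latDiff_slice, contNorm]
    rw [lintegral_finsetSum]
    · exact Finset.sum_congr rfl fun i _ => ih _ (diffOp_measurable _ _ hf)
    · exact fun i _ => latNorm_measurable τ j _ (diffOp_measurable _ _ hf)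

lemma scale_le {d : ℕ} (r : ℝ) (hr : 1 ≤ r) (g : Euc d → ℝ≥0∞) (hg : Measurable g) :
    ∫⁻ x, g (r • x) ≤ ∫⁻ x, g x := by
  have h0 : r ≠ 0 := by linarith
  have h := Measure.map_addHaar_smul (volume : Measure (Euc d)) h0
  rw [← lintegral_map hg (measurable_const_smul r), h, lintegral_smul_measure]
  refine mul_le_of_le_one_left' ?_
  rw [ENNReal.ofReal_le_one]
  rw [abs_of_nonneg (by positivity)]
  exact inv_le_one_of_one_le₀ (one_le_pow₀ hr)

lemma scale_cube {d k : ℕ} {τ : ℝ} (hτ : 0 < τ) (j : ℕ) (hj : 1 ≤ j) (hjk : j ≤ k)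
    (g : Euc d → ℝ≥0∞) (hg : Measurable g) :
    ∫⁻ x in hcube d τ, g ((j : ℝ) • x) ≤ ∫⁻ x in hcube d (k * τ), g x := by
  have hj' : (1 : ℝ) ≤ j := by exact_mod_cast hj
  have hjk' : (j : ℝ) ≤ k := by exact_mod_cast hjk
  rw [← lintegral_indicator (measurableSet_hcube d _), ← lintegral_indicator (measurableSet_hcube d _)]
  refine le_trans ?_ (scale_le (j : ℝ) hj' _ (hg.indicator (measurableSet_hcube d _)))
  refine lintegral_mono fun x => ?_
  by_cases hx : x ∈ hcube d τ
  · rw [Set.indicator_of_mem hx, Set.indicator_of_mem]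
    intro i
    have := hx i
    simp only [PiLp.smul_apply, smul_eq_mul]
    constructor
    · exact mul_nonneg (by linarith) this.1
    · calc (j : ℝ) * x i < j * τ := by
            apply mul_lt_mul_of_pos_left this.2; linarith
        _ ≤ k * τ := by gcongr
  · rw [Set.indicator_of_notMem hx]; exact zero_le

lemma count_cube {d k : ℕ} {τ : ℝ} (hτ : 0 < τ) (S : Finset (Fin d → ℤ)) (x w : Euc d) :
    ∑ n ∈ S, (hcube d (k * τ)).indicator (fun _ => (1 : ℝ≥0∞)) (x + latPt τ n - w) ≤ (k : ℝ≥0∞) ^ d := by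
  classical
  have h1 : ∀ n ∈ S, (hcube d (k * τ)).indicator (fun _ => (1 : ℝ≥0∞)) (x + latPt τ n - w) =
      if x + latPt τ n - w ∈ hcube d (k * τ) then 1 else 0 := by
    intro n _; rw [Set.indicator_apply]
  rw [Finset.sum_congr rfl h1, Finset.sum_boole]
  have h2 : S.filter (fun n => x + latPt τ n - w ∈ hcube d (k * τ)) ⊆
      Fintype.piFinset fun i => Finset.Ico ⌈(w i - x i) / τ⌉ (⌈(w i - x i) / τ⌉ + k) := by
    intro n hn
    rw [Fintype.mem_piFinset]
    intro i
    have := (Finset.mem_filter.mp hn).2 i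
    simp only [PiLp.sub_apply, PiLp.add_apply, latPt_apply] at this
    rw [Finset.mem_Ico]
    constructor
    · rw [Int.ceil_le, div_le_iff₀ hτ]; linarith [this.1]
    · have h3 : (n i : ℝ) < (w i - x i) / τ + k := by
        rw [← sub_lt_iff_lt_add, lt_div_iff₀ hτ]; linarith [this.2]
      have h4 := Int.le_ceil ((w i - x i) / τ)
      have : (n i : ℝ) < ((⌈(w i - x i) / τ⌉ + k : ℤ) : ℝ) := by push_cast; linarith
      exact_mod_cast this
  have h5 := Finset.card_le_card h2
  rw [Fintype.card_piFinset] at h5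
  simp at h5
  exact_mod_cast h5

lemma type_avg {d k : ℕ} {τ : ℝ} (hτ : 0 < τ) (v : Euc d → ℝ≥0∞) (hv : Measurable v)
    (K : ℝ≥0∞) (b : ℝ) (hb : 0 ≤ b)
    (hK : ∀ B : Set (Euc d), MeasurableSet B → ∫⁻ x in B, v x ≤ K * volume B ^ b)
    (x : Euc d) (S : Finset (Fin d → ℤ)) :
    ∑ n ∈ S, ∫⁻ z in hcube d (k * τ), v (x + latPt τ n - z) ≤
      ((k : ℝ≥0∞) ^ d * (K * (ENNReal.ofReal (k * τ) ^ d) ^ b)) * (S.card : ℝ≥0∞) ^ b := by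
  set Q := hcube d (k * τ) with hQ
  have hQm : MeasurableSet Q := measurableSet_hcube d _
  have hi : Measurable (Q.indicator fun _ : Euc d => (1 : ℝ≥0∞)) := measurable_const.indicator hQm
  have e1 : ∀ y : Euc d, ∫⁻ z in Q, v (y - z) =
      ∫⁻ w, Q.indicator (fun _ => (1 : ℝ≥0∞)) (y - w) * v w := by
    intro y
    rw [← lintegral_indicator hQm, ← lintegral_sub_left_eq_self _ y]
    congr 1; ext z
    by_cases hz : y - z ∈ Q <;> simp [hz]
  simp_rw [e1]
  rw [← lintegral_finsetSum _ (fun n _ => by fun_prop)]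
  set B : Set (Euc d) := ⋃ n ∈ S, (fun w => x + latPt τ n - w) ⁻¹' Q with hB
  have hBm : MeasurableSet B := by
    refine Finset.measurableSet_biUnion S fun n _ => ?_
    exact (measurable_const.sub measurable_id) hQm
  have hvol : volume B ≤ S.card * ENNReal.ofReal (k * τ) ^ d := by
    refine (measure_biUnion_finset_le S _).trans (le_of_eq ?_)
    have : ∀ n ∈ S, volume ((fun w => x + latPt τ n - w) ⁻¹' Q) = ENNReal.ofReal (k * τ) ^ d := by
      intro n _
      rw [(Measure.measurePreserving_sub_left volume (x + latPt τ n)).measure_preimage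
        hQm.nullMeasurableSet, hQ, volume_hcube]
    rw [Finset.sum_congr rfl this]; simp
  calc ∫⁻ w, ∑ n ∈ S, Q.indicator (fun _ => (1 : ℝ≥0∞)) (x + latPt τ n - w) * v w
      ≤ ∫⁻ w, B.indicator (fun w => (k : ℝ≥0∞) ^ d * v w) w := by
        refine lintegral_mono fun w => ?_
        rw [← Finset.sum_mul]
        by_cases hw : w ∈ B
        · rw [Set.indicator_of_mem hw]
          exact mul_le_mul_left (count_cube hτ S x w) _
        · have : ∑ n ∈ S, Q.indicator (fun _ => (1 : ℝ≥0∞)) (x + latPt τ n - w) = 0 := by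
            refine Finset.sum_eq_zero fun n hn => ?_
            rw [Set.indicator_of_notMem]
            intro h
            exact hw (Set.mem_biUnion (Finset.mem_coe.mpr hn) h)
          rw [this]; simp
    _ = (k : ℝ≥0∞) ^ d * ∫⁻ w in B, v w := by
        rw [lintegral_indicator hBm, lintegral_const_mul _ hv]
    _ ≤ (k : ℝ≥0∞) ^ d * (K * (S.card * ENNReal.ofReal (k * τ) ^ d) ^ b) := by
        refine mul_le_mul_right ((hK B hBm).trans (mul_le_mul_right ?_ _)) _
        exact ENNReal.rpow_le_rpow hvol hb
    _ = _ := by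
        rw [ENNReal.mul_rpow_of_nonneg _ _ hb]; ring

/-! ### Part 4: averaging and the weighted inequality -/

lemma norm_le_of_hcube {d : ℕ} {τ : ℝ} (h : Euc d) (hh : h ∈ hcube d τ) : ‖h‖ ≤ d * τ := by
  have : h = ∑ i : Fin d, EuclideanSpace.single i (h i) := by
    ext j; simp [Finset.sum_apply, Pi.single_apply]
  rw [this]
  refine (norm_sum_le _ _).trans ?_
  refine (Finset.sum_le_sum (g := fun _ => τ) fun i _ => ?_).trans (by simp)
  rw [PiLp.norm_single, Real.norm_of_nonneg (hh i).1]
  exact (hh i).2.le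

lemma pointwise_diff {d : ℕ} (k : ℕ) (h : Euc d) (f : Euc d → ℝ) (x : Euc d) :
    ENNReal.ofReal |f x| ≤ ENNReal.ofReal |iterDiff k h f x| +
      ∑ l ∈ Finset.range k, (k.choose (l + 1) : ℝ≥0∞) *
        ENNReal.ofReal |f (x + ((l + 1 : ℕ) : ℝ) • h)| := by
  have h1 := iterDiff_eq_sum k h f x
  rw [Finset.sum_range_succ'] at h1
  simp only [Nat.sub_zero, Nat.choose_zero_right, Nat.cast_one, mul_one, Nat.cast_zero, zero_smul,
    add_zero] at h1
  have h2 : |f x| ≤ |iterDiff k h f x| + ∑ l ∈ Finset.range k, (k.choose (l + 1) : ℝ) *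
        |f (x + ((l + 1 : ℕ) : ℝ) • h)| := by
    have e : |f x| = |iterDiff k h f x - ∑ l ∈ Finset.range k, (-1 : ℝ) ^ (k - (l + 1)) *
        (k.choose (l + 1) : ℝ) * f (x + ((l + 1 : ℕ) : ℝ) • h)| := by
      rw [h1, add_sub_cancel_left, abs_mul]; simp
    rw [e]
    refine (abs_sub _ _).trans (add_le_add le_rfl ?_)
    refine (Finset.abs_sum_le_sum_abs _ _).trans (le_of_eq ?_)
    refine Finset.sum_congr rfl fun l _ => ?_
    rw [abs_mul, abs_mul]; simp
  refine (ENNReal.ofReal_le_ofReal h2).trans (le_of_eq ?_)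
  rw [ENNReal.ofReal_add (abs_nonneg _) (Finset.sum_nonneg fun _ _ => by positivity),
    ENNReal.ofReal_sum_of_nonneg (fun _ _ => by positivity)]
  congr 1
  refine Finset.sum_congr rfl fun l _ => ?_
  rw [ENNReal.ofReal_mul (by positivity)]
  simp

lemma average_le {d k : ℕ} {τ t : ℝ} (hτ : 0 < τ) (ht : d * τ ≤ t) (f : Euc d → ℝ)
    (hf : Measurable f) (v : Euc d → ℝ≥0∞) (hv : Measurable v) (hv1 : ∀ x, v x ≤ 1) :
    ENNReal.ofReal τ ^ d * ∫⁻ x, ENNReal.ofReal |f x| * v x ≤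
      ENNReal.ofReal τ ^ d * modulusL1 k f t +
        2 ^ k * ∫⁻ x, ENNReal.ofReal |f x| * ∫⁻ z in hcube d (k * τ), v (x - z) := by
  have hQ := measurableSet_hcube d τ
  have hpt : ∀ h ∈ hcube d τ, ∫⁻ x, ENNReal.ofReal |f x| * v x ≤ modulusL1 k f t +
      ∑ l ∈ Finset.range k, (k.choose (l + 1) : ℝ≥0∞) *
        ∫⁻ y, ENNReal.ofReal |f y| * v (y - ((l + 1 : ℕ) : ℝ) • h) := by
    intro h hh
    have hm := iterDiff_measurable k h f hf
    calc ∫⁻ x, ENNReal.ofReal |f x| * v x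
        ≤ ∫⁻ x, (ENNReal.ofReal |iterDiff k h f x| + ∑ l ∈ Finset.range k,
          (k.choose (l + 1) : ℝ≥0∞) *
            (ENNReal.ofReal |f (x + ((l + 1 : ℕ) : ℝ) • h)| * v x)) := by
          refine lintegral_mono fun x => ?_
          refine (mul_le_mul_left (pointwise_diff k h f x) (v x)).trans ?_
          rw [add_mul, Finset.sum_mul]
          refine add_le_add (mul_le_of_le_one_right' (hv1 x)) (le_of_eq ?_)
          refine Finset.sum_congr rfl fun l _ => by ring
      _ = (∫⁻ x, ENNReal.ofReal |iterDiff k h f x|) + ∑ l ∈ Finset.range k,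
          (k.choose (l + 1) : ℝ≥0∞) *
            ∫⁻ x, ENNReal.ofReal |f (x + ((l + 1 : ℕ) : ℝ) • h)| * v x := by
          rw [lintegral_add_left (by fun_prop), lintegral_finsetSum _ (fun l _ => by fun_prop)]
          congr 1
          refine Finset.sum_congr rfl fun l _ => ?_
          rw [lintegral_const_mul _ (by fun_prop)]
      _ ≤ _ := by
          refine add_le_add ?_ (le_of_eq ?_)
          · unfold modulusL1
            refine le_iSup₂_of_le h ?_ le_rfl
            exact (norm_le_of_hcube h hh).trans ht
          · refine Finset.sum_congr rfl fun l _ => ?_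
            congr 1
            rw [← lintegral_add_right_eq_self
              (fun y => ENNReal.ofReal |f y| * v (y - ((l + 1 : ℕ) : ℝ) • h)) (((l + 1 : ℕ) : ℝ) • h)]
            simp
  have hI := setLIntegral_mono' (μ := volume) hQ hpt
  have hmeas : ∀ l : ℕ, Measurable fun h : Euc d =>
      ∫⁻ y, ENNReal.ofReal |f y| * v (y - ((l + 1 : ℕ) : ℝ) • h) := by
    intro l
    refine Measurable.lintegral_prod_right' (f := fun p : Euc d × Euc d =>
      ENNReal.ofReal |f p.2| * v (p.2 - ((l + 1 : ℕ) : ℝ) • p.1)) ?_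
    fun_prop
  rw [setLIntegral_const, volume_hcube, lintegral_add_left measurable_const, setLIntegral_const,
    volume_hcube, lintegral_finsetSum _ (fun l _ => (hmeas l).const_mul _)] at hI
  rw [mul_comm]
  refine hI.trans ?_
  rw [mul_comm]
  refine add_le_add le_rfl ?_
  have hterm : ∀ l ∈ Finset.range k, ∫⁻ h in hcube d τ, (k.choose (l + 1) : ℝ≥0∞) *
      ∫⁻ y, ENNReal.ofReal |f y| * v (y - ((l + 1 : ℕ) : ℝ) • h) ≤
      (k.choose (l + 1) : ℝ≥0∞) *
        ∫⁻ x, ENNReal.ofReal |f x| * ∫⁻ z in hcube d (k * τ), v (x - z) := by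
    intro l hl
    rw [lintegral_const_mul _ (hmeas l)]
    refine mul_le_mul_right ?_ _
    rw [lintegral_lintegral_swap (by
      have : Measurable fun p : Euc d × Euc d =>
        ENNReal.ofReal |f p.2| * v (p.2 - ((l + 1 : ℕ) : ℝ) • p.1) := by fun_prop
      exact this.aemeasurable)]
    refine lintegral_mono fun y => ?_
    rw [lintegral_const_mul _ (by fun_prop)]
    refine mul_le_mul_right ?_ _
    exact scale_cube hτ (l + 1) (by omega) (by have := Finset.mem_range.mp hl; omega)
      (fun z => v (y - z)) (by fun_prop)
  refine (Finset.sum_le_sum hterm).trans ?_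
  rw [← Finset.sum_mul]
  refine mul_le_mul_left ?_ _
  have : ∑ l ∈ Finset.range k, k.choose (l + 1) ≤ 2 ^ k := by
    rw [← Nat.sum_range_choose k, Finset.sum_range_succ']; omega
  exact_mod_cast this

lemma weighted {d k : ℕ} (hk0 : 0 < k) (hk : k < d) (K0 : ℝ≥0∞) (hK0 : K0 ≠ ∞) :
    ∃ C : ℝ≥0∞, C ≠ ∞ ∧ ∀ (f : Euc d → ℝ) (_ : Measurable f)
      (_ : ∫⁻ x, ENNReal.ofReal |f x| ≠ ∞) (t : ℝ) (_ : 0 < t) (v : Euc d → ℝ≥0∞)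
      (_ : Measurable v) (_ : ∀ x, v x ≤ 1)
      (_ : ∀ B : Set (Euc d), MeasurableSet B → ∫⁻ x in B, v x ≤
        K0 * ENNReal.ofReal t ^ k * volume B ^ (1 - (k : ℝ) / d)),
      ∫⁻ x, ENNReal.ofReal |f x| * v x ≤ C * modulusL1 k f t := by
  obtain ⟨C, hC, hS⟩ := lattice_sobolev (d := d) (by omega) k hk.le
  set A0 : ℝ≥0∞ := (k : ℝ≥0∞) ^ d * K0 * ((k : ℝ≥0∞) * d) ^ k * (k : ℝ≥0∞) ^ (d - k) with hA0
  have hA0t : A0 ≠ ∞ := by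
    rw [hA0]
    refine ENNReal.mul_ne_top (ENNReal.mul_ne_top (ENNReal.mul_ne_top ?_ hK0) ?_) ?_
    · exact ENNReal.pow_ne_top (by simp)
    · exact ENNReal.pow_ne_top (ENNReal.mul_ne_top (by simp) (by simp))
    · exact ENNReal.pow_ne_top (by simp)
  refine ⟨1 + 2 ^ k * (C * A0 * (d ^ k * 2 ^ k)), ?_, ?_⟩
  · refine ENNReal.add_ne_top.mpr ⟨by simp, ENNReal.mul_ne_top (ENNReal.pow_ne_top (by simp)) ?_⟩
    exact ENNReal.mul_ne_top (ENNReal.mul_ne_top hC hA0t)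
      (ENNReal.mul_ne_top (ENNReal.pow_ne_top (by simp)) (ENNReal.pow_ne_top (by simp)))
  intro f hf hfi t ht v hv hv1 hK
  have hkR : (0 : ℝ) < k := by exact_mod_cast hk0
  have hkd : (k : ℝ) < d := by exact_mod_cast hk
  have hdR : (1 : ℝ) ≤ d := by exact_mod_cast (by omega : 1 ≤ d)
  have hk1 : (1 : ℝ) ≤ k := by exact_mod_cast hk0
  set τ : ℝ := t / (k * d) with hτd
  have hτ : 0 < τ := by positivity
  have htτ : t = k * d * τ := by rw [hτd]; field_simp
  have hb : 0 ≤ 1 - (k : ℝ) / d := by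
    rw [sub_nonneg, div_le_one (by linarith)]; exact hkd.le
  have hav := average_le (k := k) hτ (t := t) (by
    rw [htτ, mul_assoc]; exact le_mul_of_one_le_left (by positivity) hk1) f hf v hv hv1
  set R : Euc d → ℝ≥0∞ := fun x => ∫⁻ z in hcube d (k * τ), v (x - z) with hR
  have hRm : Measurable R := by
    refine Measurable.lintegral_prod_right' (f := fun p : Euc d × Euc d => v (p.1 - p.2)) ?_
    fun_prop
  have hA : (k : ℝ≥0∞) ^ d * (K0 * ENNReal.ofReal t ^ k *
      (ENNReal.ofReal (k * τ) ^ d) ^ (1 - (k : ℝ) / d)) = A0 * ENNReal.ofReal τ ^ d := by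
    have e1 : (ENNReal.ofReal (k * τ) ^ d) ^ (1 - (k : ℝ) / d) =
        ENNReal.ofReal (k * τ) ^ (d - k) := by
      rw [← ENNReal.rpow_natCast, ← ENNReal.rpow_mul, ← ENNReal.rpow_natCast,
        Nat.cast_sub hk.le]
      congr 1
      field_simp
    have e2 : ENNReal.ofReal t = k * d * ENNReal.ofReal τ := by
      rw [htτ, ENNReal.ofReal_mul (by positivity), ENNReal.ofReal_mul (by positivity)]; simp
    have e3 : ENNReal.ofReal (k * τ) = k * ENNReal.ofReal τ := by
      rw [ENNReal.ofReal_mul (by positivity)]; simp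
    have e4 : ENNReal.ofReal τ ^ d = ENNReal.ofReal τ ^ k * ENNReal.ofReal τ ^ (d - k) := by
      rw [← pow_add]; congr 1; omega
    rw [e1, e2, e3, e4, hA0, mul_pow, mul_pow (k : ℝ≥0∞) (ENNReal.ofReal τ)]
    ring
  have hfR : ∫⁻ x, ENNReal.ofReal |f x| * R x ≤
      C * (A0 * ENNReal.ofReal τ ^ d) * (d ^ k * (2 ^ k * modulusL1 k f t)) := by
    rw [slice hτ _ (by fun_prop)]
    have hsum : ∀ᵐ x ∂(volume.restrict (hcube d τ)),
        ∑' n : Fin d → ℤ, ENNReal.ofReal |f (x + latPt τ n)| ≠ ∞ := by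
      have h1 := slice hτ (fun x => ENNReal.ofReal |f x|) (by fun_prop)
      rw [h1] at hfi
      refine (ae_lt_top (Measurable.tsum fun n => by fun_prop) hfi).mono fun x hx => hx.ne
    have h2 : ∀ᵐ x ∂(volume.restrict (hcube d τ)),
        ∑' n : Fin d → ℤ, ENNReal.ofReal |f (x + latPt τ n)| * R (x + latPt τ n) ≤
          C * (A0 * ENNReal.ofReal τ ^ d) * latNorm k (fun n => f (x + latPt τ n)) := by
      filter_upwards [hsum] with x hx
      refine hS (fun n => f (x + latPt τ n)) hx (fun n => R (x + latPt τ n)) _ fun S => ?_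
      rw [← hA]
      exact type_avg hτ v hv (K0 * ENNReal.ofReal t ^ k) _ hb hK x S
    refine (lintegral_mono_ae h2).trans ?_
    rw [lintegral_const_mul _ (latNorm_measurable τ k f hf), latNorm_integral hτ k f hf]
    refine mul_le_mul_right ?_ _
    refine contNorm_le (by omega) τ k f _ fun s => ?_
    refine mixDiff_norm_le k _ f hf t fun S hS => ?_
    have : ∀ j ∈ S, ‖(stepV τ (s j) : Euc d)‖ ≤ τ := fun j _ => by
      rw [stepV, PiLp.norm_single, Real.norm_of_nonneg hτ.le]
    refine (Finset.sum_le_sum this).trans ?_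
    simp only [Finset.sum_const, nsmul_eq_mul]
    have hc : (S.card : ℝ) ≤ k := by
      have := Finset.card_le_card hS
      rw [Finset.card_range] at this
      exact_mod_cast this
    rw [htτ]
    have : (k : ℝ) ≤ k * d := le_mul_of_one_le_right hkR.le hdR
    exact mul_le_mul_of_nonneg_right (hc.trans this) hτ.le
  have h0 : ENNReal.ofReal τ ^ d ≠ 0 := by
    apply pow_ne_zero; simpa using hτ
  have h1 : ENNReal.ofReal τ ^ d ≠ ∞ := ENNReal.pow_ne_top (by simp)
  rw [← ENNReal.mul_le_mul_iff_right h0 h1]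
  refine hav.trans ((add_le_add le_rfl (mul_le_mul_right hfR _)).trans (le_of_eq ?_))
  ring

/-! ### Part 5: rearrangements -/

lemma lint_Ioi_rpow {a r : ℝ} (ha : 0 < a) (hr : 0 < r) :
    ∫⁻ u in Set.Ioi r, ENNReal.ofReal (u ^ (-a - 1)) = ENNReal.ofReal (r ^ (-a) / a) := by
  rw [← ofReal_integral_eq_lintegral_ofReal (integrableOn_Ioi_rpow_of_lt (by linarith) hr)]
  · rw [integral_Ioi_rpow_of_lt (by linarith) hr]
    congr 1
    rw [show -a - 1 + 1 = -a by ring, neg_div_neg_eq]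
  · refine (ae_restrict_iff' measurableSet_Ioi).mpr (Eventually.of_forall fun u hu => ?_)
    exact Real.rpow_nonneg (hr.trans hu).le _

lemma lint_Ioc_rpow {a r : ℝ} (ha : a < 1) (hr : 0 < r) :
    ∫⁻ u in Set.Ioc 0 r, ENNReal.ofReal (u ^ (-a)) = ENNReal.ofReal (r ^ (1 - a) / (1 - a)) := by
  have hi : IntervalIntegrable (fun u : ℝ => u ^ (-a)) volume 0 r :=
    intervalIntegral.intervalIntegrable_rpow' (by linarith)
  rw [← ofReal_integral_eq_lintegral_ofReal
    ((intervalIntegrable_iff_integrableOn_Ioc_of_le hr.le).mp hi)]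
  · rw [← intervalIntegral.integral_of_le hr.le, integral_rpow (Or.inl (by linarith))]
    congr 1
    rw [show -a + 1 = 1 - a by ring, Real.zero_rpow (by linarith), sub_zero]
  · refine (ae_restrict_iff' measurableSet_Ioc).mpr (Eventually.of_forall fun u hu => ?_)
    exact Real.rpow_nonneg hu.1.le _

/-- The constant in `psi_le`. -/
def psiC (a : ℝ) : ℝ≥0∞ := ENNReal.ofReal (1 / (1 - a) + 1 / a)

lemma psi_le {a : ℝ} (ha0 : 0 < a) (ha1 : a < 1) (m : ℝ≥0∞) :
    ∫⁻ u in Set.Ioi (0 : ℝ), ENNReal.ofReal (u ^ (-a - 1)) * min (ENNReal.ofReal u) m ≤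
      psiC a * m ^ (1 - a) := by
  have h1 : 0 < 1 - a := by linarith
  have hpos : 0 < 1 / (1 - a) + 1 / a := by positivity
  rcases eq_or_ne m 0 with hm | hm0
  · subst hm; simp
  rcases eq_or_ne m ∞ with hm | hm
  · subst hm
    rw [ENNReal.top_rpow_of_pos h1, psiC, ENNReal.mul_top (by simpa using hpos)]
    exact le_top
  obtain ⟨r, hr, rfl⟩ : ∃ r : ℝ, 0 < r ∧ m = ENNReal.ofReal r :=
    ⟨m.toReal, ENNReal.toReal_pos hm0 hm, (ENNReal.ofReal_toReal hm).symm⟩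
  rw [← Set.Ioc_union_Ioi_eq_Ioi hr.le]
  refine (lintegral_union_le _ _ _).trans ?_
  have b1 : ∫⁻ u in Set.Ioc 0 r, ENNReal.ofReal (u ^ (-a - 1)) *
      min (ENNReal.ofReal u) (ENNReal.ofReal r) ≤ ENNReal.ofReal (r ^ (1 - a) / (1 - a)) := by
    rw [← lint_Ioc_rpow ha1 hr]
    refine setLIntegral_mono' measurableSet_Ioc fun u hu => ?_
    refine (mul_le_mul_right (min_le_left _ _) _).trans (le_of_eq ?_)
    rw [← ENNReal.ofReal_mul (Real.rpow_nonneg hu.1.le _), ← Real.rpow_add_one hu.1.ne']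
    congr 2; ring
  have b2 : ∫⁻ u in Set.Ioi r, ENNReal.ofReal (u ^ (-a - 1)) *
      min (ENNReal.ofReal u) (ENNReal.ofReal r) ≤ ENNReal.ofReal (r ^ (1 - a) / a) := by
    calc _ ≤ ∫⁻ u in Set.Ioi r, ENNReal.ofReal (u ^ (-a - 1)) * ENNReal.ofReal r :=
          lintegral_mono fun u => mul_le_mul_right (min_le_right _ _) _
      _ = ENNReal.ofReal (r ^ (-a) / a) * ENNReal.ofReal r := by
          rw [lintegral_mul_const _ (by fun_prop), lint_Ioi_rpow ha0 hr]
      _ = _ := by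
          rw [← ENNReal.ofReal_mul (by positivity)]
          congr 1
          rw [show 1 - a = -a + 1 by ring, Real.rpow_add_one hr.ne']
          ring
  refine (add_le_add b1 b2).trans (le_of_eq ?_)
  rw [psiC, ENNReal.ofReal_rpow_of_pos hr, ← ENNReal.ofReal_mul hpos.le,
    ← ENNReal.ofReal_add (by positivity) (by positivity)]
  congr 1; ring

lemma psi_le' {d k : ℕ} (hk0 : 0 < k) (hk : k < d) {t : ℝ} (ht : 0 < t) (m : ℝ≥0∞) :
    ENNReal.ofReal (t ^ k) * ∫⁻ u in Set.Ioi (t ^ d), ENNReal.ofReal (u ^ (-((k : ℝ) / d) - 1)) *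
      min (ENNReal.ofReal u) m ≤ (psiC ((k : ℝ) / d) + ENNReal.ofReal (d / k)) *
        min m (ENNReal.ofReal t ^ k * m ^ (1 - (k : ℝ) / d)) := by
  have hkR : (0 : ℝ) < k := by exact_mod_cast hk0
  have hkd : (k : ℝ) < d := by exact_mod_cast hk
  have hdR : (0 : ℝ) < d := by linarith
  set a : ℝ := (k : ℝ) / d with ha
  have ha0 : 0 < a := by positivity
  have ha1 : a < 1 := by rw [ha, div_lt_one hdR]; exact hkd
  have htd : 0 < t ^ d := by positivity
  rw [mul_min]
  refine le_min ?_ ?_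
  · calc _ ≤ ENNReal.ofReal (t ^ k) * ∫⁻ u in Set.Ioi (t ^ d),
          ENNReal.ofReal (u ^ (-a - 1)) * m :=
          mul_le_mul_right (lintegral_mono fun u => mul_le_mul_right (min_le_right _ _) _) _
      _ = ENNReal.ofReal (d / k) * m := by
          rw [lintegral_mul_const _ (by fun_prop), lint_Ioi_rpow ha0 htd, ← mul_assoc,
            ← ENNReal.ofReal_mul (by positivity)]
          congr 2
          have : (t ^ d) ^ (-a) = (t ^ k)⁻¹ := by
            rw [← Real.rpow_natCast, ← Real.rpow_mul ht.le, ← Real.rpow_natCast,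
              ← Real.rpow_neg ht.le]
            congr 1
            rw [ha]; field_simp
          rw [this, ha]
          field_simp
      _ ≤ _ := mul_le_mul_left le_add_self _
  · calc _ ≤ ENNReal.ofReal (t ^ k) * (psiC a * m ^ (1 - a)) := by
          refine mul_le_mul_right (le_trans ?_ (psi_le ha0 ha1 m)) _
          exact lintegral_mono_set (Set.Ioi_subset_Ioi htd.le)
      _ = psiC a * (ENNReal.ofReal t ^ k * m ^ (1 - a)) := by
          rw [ENNReal.ofReal_pow ht.le]; ring
      _ ≤ _ := mul_le_mul_left le_self_add _

/-- Continuous rank function. -/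
def rankM {d : ℕ} (f : Euc d → ℝ) (x : Euc d) : ℝ≥0∞ := volume {y | |f x| ≤ |f y|}

lemma rankM_measurable {d : ℕ} (f : Euc d → ℝ) (hf : Measurable f) : Measurable (rankM f) := by
  have h : Antitone fun r : ℝ => volume {y | r ≤ |f y|} := fun r s hrs =>
    measure_mono fun y hy => le_trans hrs hy
  exact h.measurable.comp (by fun_prop : Measurable fun x => |f x|)

lemma rankM_le {d : ℕ} (f : Euc d → ℝ) (c : ℝ≥0∞) : volume {x | rankM f x ≤ c} ≤ c := by
  set T := {x | rankM f x ≤ c} with hT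
  rcases T.eq_empty_or_nonempty with h0 | h0
  · rw [h0]; simp
  set J := Set.image (fun x => |f x|) T with hJ
  have hJ0 : J.Nonempty := h0.image _
  have hJb : BddBelow J := ⟨0, by rintro _ ⟨x, _, rfl⟩; exact abs_nonneg _⟩
  by_cases hin : sInf J ∈ J
  · obtain ⟨x, hx, hxe⟩ := hin
    refine le_trans (measure_mono fun y hy => ?_) hx
    exact (le_of_eq hxe).trans (csInf_le hJb ⟨y, hy, rfl⟩)
  · obtain ⟨u, hu, htend, hmem⟩ := exists_seq_tendsto_sInf hJ0 hJb
    have hsub : T ⊆ ⋃ n, {y | u n ≤ |f y|} := by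
      intro y hy
      have hlt : sInf J < |f y| := by
        refine lt_of_le_of_ne (csInf_le hJb ⟨y, hy, rfl⟩) fun h => hin ?_
        rw [h]; exact ⟨y, hy, rfl⟩
      obtain ⟨n, hn⟩ := (htend.eventually (gt_mem_nhds hlt)).exists
      exact Set.mem_iUnion.mpr ⟨n, hn.le⟩
    refine (measure_mono hsub).trans ?_
    have hmono : Monotone (fun n => {y : Euc d | u n ≤ |f y|}) :=
      fun m n hmn y hy => le_trans (hu hmn) hy
    rw [hmono.measure_iUnion]
    refine iSup_le fun n => ?_
    obtain ⟨x, hx, hxe⟩ := hmem n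
    rw [← hxe]
    exact hx

lemma rankM_type {d : ℕ} (f : Euc d → ℝ) (hf : Measurable f) {a : ℝ} (ha0 : 0 < a) (ha1 : a < 1)
    (B : Set (Euc d)) :
    ∫⁻ x in B, rankM f x ^ (-a) ≤ ENNReal.ofReal a * psiC a * volume B ^ (1 - a) := by
  have hM := rankM_measurable f hf
  have hset : MeasurableSet {p : Euc d × ℝ | rankM f p.1 ≤ ENNReal.ofReal p.2} :=
    measurableSet_le (by fun_prop) (by fun_prop)
  have hset2 : ∀ s : ℝ, MeasurableSet {x : Euc d | rankM f x ≤ ENNReal.ofReal s} := fun s =>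
    measurableSet_le hM measurable_const
  have h0 : ∀ᵐ x ∂(volume.restrict B), rankM f x ≠ 0 := by
    refine ae_restrict_of_ae ?_
    rw [ae_iff]
    have := rankM_le f 0
    simpa using this
  set G : Euc d → ℝ → ℝ≥0∞ := fun x s => ENNReal.ofReal (s ^ (-a - 1)) *
    ({p : Euc d × ℝ | rankM f p.1 ≤ ENNReal.ofReal p.2}.indicator (fun _ => 1) (x, s)) with hG
  have hGm : Measurable (Function.uncurry G) := by
    refine Measurable.mul (by fun_prop) ?_
    exact measurable_const.indicator hset
  have hpt : ∀ x, rankM f x ≠ 0 →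
      rankM f x ^ (-a) ≤ ENNReal.ofReal a * ∫⁻ s in Set.Ioi (0 : ℝ), G x s := by
    intro x hx
    rcases eq_or_ne (rankM f x) ∞ with hm | hm
    · rw [hm, ENNReal.top_rpow_of_neg (by linarith)]; exact zero_le
    obtain ⟨r, hr, hre⟩ : ∃ r : ℝ, 0 < r ∧ rankM f x = ENNReal.ofReal r :=
      ⟨_, ENNReal.toReal_pos hx hm, (ENNReal.ofReal_toReal hm).symm⟩
    calc rankM f x ^ (-a) = ENNReal.ofReal a * ∫⁻ s in Set.Ioi r, ENNReal.ofReal (s ^ (-a - 1)) := by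
          rw [lint_Ioi_rpow ha0 hr, hre, ENNReal.ofReal_rpow_of_pos hr,
            ← ENNReal.ofReal_mul ha0.le]
          congr 1; field_simp
      _ = ENNReal.ofReal a * ∫⁻ s in Set.Ioi r, G x s := by
          congr 1
          refine setLIntegral_congr_fun measurableSet_Ioi fun s hs => ?_
          simp only [hG]
          rw [Set.indicator_of_mem, mul_one]
          change rankM f x ≤ ENNReal.ofReal s
          rw [hre]; exact ENNReal.ofReal_le_ofReal (le_of_lt hs)
      _ ≤ _ := mul_le_mul_right (lintegral_mono_set (Set.Ioi_subset_Ioi hr.le)) _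
  calc ∫⁻ x in B, rankM f x ^ (-a)
      ≤ ∫⁻ x in B, ENNReal.ofReal a * ∫⁻ s in Set.Ioi (0 : ℝ), G x s :=
        lintegral_mono_ae (h0.mono fun x hx => hpt x hx)
    _ = ENNReal.ofReal a * ∫⁻ s in Set.Ioi (0 : ℝ), ∫⁻ x in B, G x s := by
        have hGi : Measurable fun x => ∫⁻ s in Set.Ioi (0 : ℝ), G x s :=
          Measurable.lintegral_prod_right' hGm
        rw [lintegral_const_mul _ hGi,
          lintegral_lintegral_swap hGm.aemeasurable]
    _ ≤ ENNReal.ofReal a * ∫⁻ s in Set.Ioi (0 : ℝ), ENNReal.ofReal (s ^ (-a - 1)) *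
          min (ENNReal.ofReal s) (volume B) := by
        refine mul_le_mul_right (lintegral_mono fun s => ?_) _
        have e : ∀ x, G x s = ENNReal.ofReal (s ^ (-a - 1)) *
            {x : Euc d | rankM f x ≤ ENNReal.ofReal s}.indicator (fun _ => 1) x := fun x => rfl
        simp_rw [e]
        rw [lintegral_const_mul _ (measurable_const.indicator (hset2 s)),
          lintegral_indicator (hset2 s), setLIntegral_const, one_mul]
        refine mul_le_mul_right (le_min ?_ ?_) _
        · exact (Measure.restrict_apply_le _ _).trans (rankM_le f _)
        · exact (measure_mono (Set.subset_univ _)).trans (by simp)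
    _ ≤ _ := by
        rw [mul_assoc]
        exact mul_le_mul_right (psi_le ha0 ha1 _) _

lemma le_lint_indicator (c : ℝ≥0∞) :
    c ≤ ∫⁻ l in Set.Ioi (0 : ℝ), {l : ℝ | ENNReal.ofReal l < c}.indicator (fun _ => 1) l := by
  have hm : MeasurableSet {l : ℝ | ENNReal.ofReal l < c} :=
    measurableSet_lt (by fun_prop) measurable_const
  rw [lintegral_indicator hm, setLIntegral_const, one_mul, Measure.restrict_apply hm]
  rcases eq_or_ne c ∞ with hc | hc
  · subst hc
    simp
  · have : Set.Ioo 0 c.toReal ⊆ {l : ℝ | ENNReal.ofReal l < c} ∩ Set.Ioi 0 := fun l hl =>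
      ⟨(ENNReal.ofReal_lt_iff_lt_toReal hl.1.le hc).mpr hl.2, hl.1⟩
    refine le_trans ?_ (measure_mono this)
    rw [Real.volume_Ioo, sub_zero, ENNReal.ofReal_toReal hc]

lemma lint_rearr_le {d : ℕ} (f : Euc d → ℝ) (u : ℝ) :
    ∫⁻ s in Set.Ioo (0 : ℝ) u, rearrR volume f s ≤
      ∫⁻ l in Set.Ioi (0 : ℝ), min (ENNReal.ofReal u) (volume {x | l < |f x|}) := by
  set D : ℝ → ℝ≥0∞ := fun l => volume {x | l < |f x|} with hD
  have hDm : Measurable D := by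
    have : Antitone D := fun r s hrs => measure_mono fun y hy => lt_of_le_of_lt hrs hy
    exact this.measurable
  have hset : MeasurableSet {p : ℝ × ℝ | ENNReal.ofReal p.1 < D p.2} :=
    measurableSet_lt (by fun_prop) (by fun_prop)
  set G : ℝ → ℝ → ℝ≥0∞ := fun s l =>
    {p : ℝ × ℝ | ENNReal.ofReal p.1 < D p.2}.indicator (fun _ => 1) (s, l) with hG
  have hGm : Measurable (Function.uncurry G) := measurable_const.indicator hset
  have hpt : ∀ s, rearrR volume f s ≤ ∫⁻ l in Set.Ioi (0 : ℝ), G s l := by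
    intro s
    refine (le_lint_indicator _).trans (setLIntegral_mono' measurableSet_Ioi fun l hl => ?_)
    by_cases h : ENNReal.ofReal l < rearrR volume f s
    · have : ENNReal.ofReal s < D l := by
        by_contra hcon
        refine absurd h (not_lt.mpr (sInf_le ?_))
        change volume {x | ENNReal.ofReal l < ENNReal.ofReal |f x|} ≤ ENNReal.ofReal s
        refine le_trans (measure_mono fun x hx => ?_) (not_lt.mp hcon)
        exact (ENNReal.ofReal_lt_ofReal_iff_of_nonneg (le_of_lt hl)).mp hx
      simp only [hG]
      rw [Set.indicator_of_mem (show l ∈ {l : ℝ | ENNReal.ofReal l < rearrR volume f s} from h),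
        Set.indicator_of_mem (show (s, l) ∈ {p : ℝ × ℝ | ENNReal.ofReal p.1 < D p.2} from this)]
    · rw [Set.indicator_of_notMem (show l ∉ {l : ℝ | ENNReal.ofReal l < rearrR volume f s} from h)]
      exact zero_le
  refine (lintegral_mono hpt).trans ?_
  rw [lintegral_lintegral_swap hGm.aemeasurable]
  refine lintegral_mono fun l => ?_
  have hs2 : MeasurableSet {s : ℝ | ENNReal.ofReal s < D l} :=
    measurableSet_lt (by fun_prop) measurable_const
  have e : ∀ s, G s l = {s : ℝ | ENNReal.ofReal s < D l}.indicator (fun _ => 1) s := fun s => rfl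
  simp_rw [e]
  rw [lintegral_indicator hs2, setLIntegral_const, one_mul, Measure.restrict_apply hs2]
  refine le_min ?_ ?_
  · refine (measure_mono Set.inter_subset_right).trans ?_
    rw [Real.volume_Ioo, sub_zero]
  · rcases eq_or_ne (D l) ∞ with hc | hc
    · exact le_of_le_of_eq le_top hc.symm
    · have : {s : ℝ | ENNReal.ofReal s < D l} ∩ Set.Ioo 0 u ⊆ Set.Ioo 0 (D l).toReal := fun s hs =>
        ⟨hs.2.1, (ENNReal.ofReal_lt_iff_lt_toReal hs.2.1.le hc).mp hs.1⟩
      refine (measure_mono this).trans ?_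
      rw [Real.volume_Ioo, sub_zero, ENNReal.ofReal_toReal hc]

/-! ### Part 6: assembly -/

/-- The weight attached to `f` at scale `t`. -/
def wgt {d : ℕ} (k : ℕ) (f : Euc d → ℝ) (t : ℝ) (x : Euc d) : ℝ≥0∞ :=
  min 1 (ENNReal.ofReal t ^ k * rankM f x ^ (-((k : ℝ) / d)))

lemma wgt_measurable {d : ℕ} (k : ℕ) (f : Euc d → ℝ) (hf : Measurable f) (t : ℝ) :
    Measurable (wgt k f t) := by
  have hM := rankM_measurable f hf
  unfold wgt
  exact measurable_const.min ((hM.pow_const _).const_mul _)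

lemma level_le {d k : ℕ} (f : Euc d → ℝ) (hf : Measurable f)
    (hfi : ∫⁻ x, ENNReal.ofReal |f x| ≠ ∞) (t : ℝ) {l : ℝ} (hl : 0 < l) :
    min (volume {x | l < |f x|}) (ENNReal.ofReal t ^ k *
      volume {x | l < |f x|} ^ (1 - (k : ℝ) / d)) ≤ ∫⁻ x in {x | l < |f x|}, wgt k f t x := by
  set E := {x | l < |f x|} with hE
  have hEm : MeasurableSet E := measurableSet_lt measurable_const (by fun_prop)
  rcases eq_or_ne (volume E) 0 with h0 | h0
  · rw [h0, min_eq_left zero_le]; exact zero_le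
  have hfin : volume E ≠ ∞ := by
    have h1 : volume E ≤ volume {x | ENNReal.ofReal l ≤ ENNReal.ofReal |f x|} :=
      measure_mono fun x hx => ENNReal.ofReal_le_ofReal (le_of_lt hx)
    have h2 := mul_meas_ge_le_lintegral (μ := (volume : Measure (Euc d)))
      (f := fun x => ENNReal.ofReal |f x|) (by fun_prop) (ENNReal.ofReal l)
    intro htop
    rw [htop, top_le_iff] at h1
    rw [h1, ENNReal.mul_top (by simpa using hl)] at h2
    exact hfi (top_le_iff.mp h2)
  calc _ = min 1 (ENNReal.ofReal t ^ k * volume E ^ (-((k : ℝ) / d))) * volume E := by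
        rw [min_mul, one_mul, mul_assoc]
        congr 2
        rw [show 1 - (k : ℝ) / d = -((k : ℝ) / d) + 1 by ring, ENNReal.rpow_add _ _ h0 hfin,
          ENNReal.rpow_one]
    _ = ∫⁻ x in E, min 1 (ENNReal.ofReal t ^ k * volume E ^ (-((k : ℝ) / d))) := by
        rw [setLIntegral_const]
    _ ≤ _ := by
        refine setLIntegral_mono' hEm fun x hx => ?_
        refine min_le_min le_rfl (mul_le_mul_right ?_ _)
        refine ennreal_rpow_anti (by positivity) (measure_mono fun y hy => ?_)
        change |f x| ≤ |f y| at hy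
        change l < |f x| at hx
        exact lt_of_lt_of_le hx hy

lemma layer {d : ℕ} (f : Euc d → ℝ) (hf : Measurable f) (v : Euc d → ℝ≥0∞) (hv : Measurable v) :
    ∫⁻ l in Set.Ioi (0 : ℝ), ∫⁻ x in {x | l < |f x|}, v x = ∫⁻ x, ENNReal.ofReal |f x| * v x := by
  have hset : MeasurableSet {p : ℝ × Euc d | p.1 < |f p.2|} :=
    measurableSet_lt (by fun_prop) (by fun_prop)
  set G : ℝ → Euc d → ℝ≥0∞ := fun l x =>
    {p : ℝ × Euc d | p.1 < |f p.2|}.indicator (fun p => v p.2) (l, x) with hG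
  have hGm : Measurable (Function.uncurry G) :=
    Measurable.indicator (by fun_prop) hset
  have e1 : ∀ l : ℝ, ∫⁻ x in {x | l < |f x|}, v x = ∫⁻ x, G l x := by
    intro l
    rw [← lintegral_indicator (measurableSet_lt measurable_const (by fun_prop))]
    rfl
  simp_rw [e1]
  rw [lintegral_lintegral_swap hGm.aemeasurable]
  refine lintegral_congr fun x => ?_
  have e2 : ∀ l, G l x = (Set.Iio |f x|).indicator (fun _ => v x) l := fun l => rfl
  simp_rw [e2]
  rw [lintegral_indicator measurableSet_Iio, setLIntegral_const,
    Measure.restrict_apply measurableSet_Iio, mul_comm, Set.inter_comm]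
  congr 1
  rw [Set.Ioi_inter_Iio, Real.volume_Ioo, sub_zero]

lemma main_meas {d k : ℕ} (hk0 : 0 < k) (hk : k < d) (f : Euc d → ℝ) (hf : Measurable f)
    (hfi : ∫⁻ x, ENNReal.ofReal |f x| ≠ ∞) (t : ℝ) (ht : 0 < t) :
    ENNReal.ofReal (t ^ k) * ∫⁻ u in Set.Ioi (t ^ d),
      ENNReal.ofReal (u ^ (1 - (k : ℝ) / d)) * rearrStar volume f u / ENNReal.ofReal u ≤
    (psiC ((k : ℝ) / d) + ENNReal.ofReal (d / k)) * ∫⁻ x, ENNReal.ofReal |f x| * wgt k f t x := by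
  have htd : 0 < t ^ d := by positivity
  set a : ℝ := (k : ℝ) / d with ha
  set D : ℝ → ℝ≥0∞ := fun l => volume {x | l < |f x|} with hD
  have hDm : Measurable D := by
    have : Antitone D := fun r s hrs => measure_mono fun y hy => lt_of_le_of_lt hrs hy
    exact this.measurable
  have hGm : Measurable (Function.uncurry fun (u l : ℝ) =>
      ENNReal.ofReal (u ^ (-a - 1)) * min (ENNReal.ofReal u) (D l)) := by
    refine Measurable.mul (by fun_prop) (Measurable.min (by fun_prop) ?_)
    exact hDm.comp measurable_snd
  have hpt : ∀ u ∈ Set.Ioi (t ^ d),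
      ENNReal.ofReal (u ^ (1 - a)) * rearrStar volume f u / ENNReal.ofReal u ≤
      ∫⁻ l in Set.Ioi (0 : ℝ), ENNReal.ofReal (u ^ (-a - 1)) * min (ENNReal.ofReal u) (D l) := by
    intro u hu
    have hu0 : 0 < u := htd.trans hu
    rw [lintegral_const_mul _ (measurable_const.min hDm)]
    unfold rearrStar
    calc _ = ENNReal.ofReal (u ^ (-a - 1)) * ∫⁻ s in Set.Ioo (0 : ℝ) u, rearrR volume f s := by
          rw [div_eq_mul_inv, ← mul_assoc, mul_right_comm]
          congr 1
          rw [← ENNReal.ofReal_inv_of_pos hu0, ← ENNReal.ofReal_mul (by positivity),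
            ← ENNReal.ofReal_mul (by positivity)]
          congr 1
          rw [show 1 - a = -a - 1 + 1 + 1 by ring, Real.rpow_add_one hu0.ne',
            Real.rpow_add_one hu0.ne']
          field_simp
      _ ≤ _ := mul_le_mul_right (lint_rearr_le f u) _
  calc _ ≤ ENNReal.ofReal (t ^ k) * ∫⁻ u in Set.Ioi (t ^ d), ∫⁻ l in Set.Ioi (0 : ℝ),
        ENNReal.ofReal (u ^ (-a - 1)) * min (ENNReal.ofReal u) (D l) :=
        mul_le_mul_right (setLIntegral_mono' measurableSet_Ioi hpt) _
    _ = ∫⁻ l in Set.Ioi (0 : ℝ), ENNReal.ofReal (t ^ k) * ∫⁻ u in Set.Ioi (t ^ d),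
        ENNReal.ofReal (u ^ (-a - 1)) * min (ENNReal.ofReal u) (D l) := by
        rw [lintegral_lintegral_swap hGm.aemeasurable, lintegral_const_mul' _ _ (by simp)]
    _ ≤ ∫⁻ l in Set.Ioi (0 : ℝ), (psiC a + ENNReal.ofReal (d / k)) *
          ∫⁻ x in {x | l < |f x|}, wgt k f t x := by
        refine setLIntegral_mono' measurableSet_Ioi fun l hl => ?_
        exact (psi_le' hk0 hk ht (D l)).trans (mul_le_mul_right (level_le f hf hfi t hl) _)
    _ = _ := by
        rw [lintegral_const_mul' _ _ (by simp [psiC]), layer f hf _ (wgt_measurable k f hf t)]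

lemma main_thm {d k : ℕ} (hk0 : 0 < k) (hk : k < d) :
    ∃ C : ℝ≥0∞, C ≠ ∞ ∧ ∀ (f : Euc d → ℝ) (_ : Measurable f)
      (_ : ∫⁻ x, ENNReal.ofReal |f x| ≠ ∞) (t : ℝ) (_ : 0 < t),
      ENNReal.ofReal (t ^ k) * ∫⁻ u in Set.Ioi (t ^ d),
        ENNReal.ofReal (u ^ (1 - (k : ℝ) / d)) * rearrStar volume f u / ENNReal.ofReal u ≤
      C * modulusL1 k f t := by
  have hkR : (0 : ℝ) < k := by exact_mod_cast hk0
  have hkd : (k : ℝ) < d := by exact_mod_cast hk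
  have hdR : (0 : ℝ) < d := by linarith
  have ha0 : 0 < (k : ℝ) / d := by positivity
  have ha1 : (k : ℝ) / d < 1 := by rw [div_lt_one hdR]; exact hkd
  obtain ⟨C, hC, hW⟩ := weighted hk0 hk (ENNReal.ofReal ((k : ℝ) / d) * psiC ((k : ℝ) / d))
    (ENNReal.mul_ne_top (by simp) (by simp [psiC]))
  refine ⟨(psiC ((k : ℝ) / d) + ENNReal.ofReal (d / k)) * C,
    ENNReal.mul_ne_top (by simp [psiC]) hC, fun f hf hfi t ht => ?_⟩
  refine (main_meas hk0 hk f hf hfi t ht).trans ?_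
  rw [mul_assoc]
  refine mul_le_mul_right ?_ _
  refine hW f hf hfi t ht _ (wgt_measurable k f hf t) (fun x => min_le_left _ _) fun B _ => ?_
  calc ∫⁻ x in B, wgt k f t x
      ≤ ∫⁻ x in B, ENNReal.ofReal t ^ k * rankM f x ^ (-((k : ℝ) / d)) :=
        lintegral_mono fun x => min_le_right _ _
    _ = ENNReal.ofReal t ^ k * ∫⁻ x in B, rankM f x ^ (-((k : ℝ) / d)) :=
        lintegral_const_mul' _ _ (by simp)
    _ ≤ ENNReal.ofReal t ^ k * (ENNReal.ofReal ((k : ℝ) / d) * psiC ((k : ℝ) / d) *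
          volume B ^ (1 - (k : ℝ) / d)) := mul_le_mul_right (rankM_type f hf ha0 ha1 B) _
    _ = _ := by ring

lemma modulusL1_congr {d : ℕ} (k : ℕ) {f g : Euc d → ℝ} (h : f =ᵐ[volume] g) (t : ℝ) :
    modulusL1 k f t = modulusL1 k g t := by
  unfold modulusL1
  refine iSup_congr fun y => iSup_congr fun _ => lintegral_congr_ae ?_
  have h1 : ∀ l : ℕ, ∀ᵐ x : Euc d, f (x + (l : ℝ) • y) = g (x + (l : ℝ) • y) := fun l =>
    (measurePreserving_add_right volume ((l : ℝ) • y)).quasiMeasurePreserving.ae_eq_comp h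
  filter_upwards [ae_all_iff.mpr h1] with x hx
  rw [iterDiff_eq_sum, iterDiff_eq_sum]
  simp_rw [hx]

lemma rearrStar_congr {d : ℕ} {f g : Euc d → ℝ} (h : f =ᵐ[volume] g) (u : ℝ) :
    rearrStar volume f u = rearrStar volume g u := by
  unfold rearrStar
  congr 1
  refine lintegral_congr fun s => ?_
  unfold rearrR rearr
  congr 1
  ext l
  have : volume {x | l < ENNReal.ofReal |f x|} = volume {x | l < ENNReal.ofReal |g x|} := by
    refine measure_congr ?_
    filter_upwards [h] with x hx
    change (l < ENNReal.ofReal |f x|) = (l < ENNReal.ofReal |g x|)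
    rw [hx]
  change volume {x | l < ENNReal.ofReal |f x|} ≤ ENNReal.ofReal s ↔
    volume {x | l < ENNReal.ofReal |g x|} ≤ ENNReal.ofReal s
  rw [this]

/-- `t^k ∫_{t^d}^∞ u^{1-k/d} f^{**}(u) du/u ≲ ω_k(f,t)_1` for `k < d`
(Theorem 1.1, (1.10)). -/
theorem statement3 (d : ℕ) (k : ℕ) (hk0 : 0 < k) (hk : k < d) :
    ∃ C : ℝ, 0 < C ∧ ∀ f : Euc d → ℝ, Integrable f volume →
      ∀ t : ℝ, 0 < t →
        ENNReal.ofReal (t ^ k) *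
            ∫⁻ u in Set.Ioi (t ^ d),
              ENNReal.ofReal (u ^ (1 - (k : ℝ) / d)) * rearrStar volume f u / ENNReal.ofReal u ≤
          ENNReal.ofReal C * modulusL1 k f t := by
  obtain ⟨C, hC, hM⟩ := main_thm hk0 hk
  refine ⟨C.toReal + 1, by positivity, fun f hf t ht => ?_⟩
  have hae : f =ᵐ[volume] hf.1.mk f := hf.1.ae_eq_mk
  have hgm : Measurable (hf.1.mk f) := hf.1.stronglyMeasurable_mk.measurable
  have hgi : Integrable (hf.1.mk f) volume := hf.congr hae
  have hfin : ∫⁻ x, ENNReal.ofReal |hf.1.mk f x| ≠ ∞ := by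
    have h2 := hgi.2.ne
    simpa only [← ofReal_norm, Real.norm_eq_abs] using h2
  simp_rw [rearrStar_congr hae, modulusL1_congr k hae]
  refine (hM _ hgm hfin t ht).trans (mul_le_mul_left ?_ _)
  rw [ENNReal.ofReal_add (by positivity) (by positivity), ENNReal.ofReal_toReal hC]
  exact le_self_add

end
end

section
/- Let μ be a positive Radon measure on ℝ^d satisfying the doubling condition, Q0 a cube, 1 < p < ∞, and 0 < r ≤ ∞. There is C > 0 such that for every f ∈ L_{p,r}(Q0,μ) and every t ∈ (0,1), ∫_0^{t(1−log t)^{−p}} (u^{1/p} ((f − f_{Q0;μ})^*_μ(u))^r du/u ≤ C ∫_0^{t} (u^{1/p} ((f^#_{Q0;μ})^*_μ(u))^r du/u (usual modification if r = ∞). -/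
open MeasureTheory ENNReal Set Filter

noncomputable section

def supBall {d : ℕ} (z : Euc d) (h : ℝ) : Set (Euc d) := {x | ∀ i, |x i - z i| ≤ h}

lemma supBall_eq_cubeSet {d : ℕ} (z : Euc d) (h : ℝ) :
    supBall z h = cubeSet (fun i => z i - h) (2 * h) := by
  ext x
  simp only [supBall, cubeSet, mem_ofPred_eq, abs_le]
  refine forall_congr' fun i => ⟨fun ⟨a, b⟩ => ⟨by linarith, by linarith⟩,
    fun ⟨a, b⟩ => ⟨by linarith, by linarith⟩⟩

lemma cubeSet_eq_supBall {d : ℕ} (a : Fin d → ℝ) (l : ℝ) :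
    cubeSet a l = supBall (WithLp.toLp 2 fun i => a i + l / 2) (l / 2) := by
  rw [supBall_eq_cubeSet]
  congr 1
  · ext i; simp
  · ring

lemma supBall_isCube {d : ℕ} (z : Euc d) {h : ℝ} (hh : 0 < h) : IsCube (supBall z h) :=
  ⟨_, _, by positivity, supBall_eq_cubeSet z h⟩

lemma supBall_isClosed {d : ℕ} (z : Euc d) (h : ℝ) : IsClosed (supBall z h) := by
  simp only [supBall, ofPred_forall]
  exact isClosed_iInter fun i => isClosed_le (by fun_prop) continuous_const

lemma supBall_isCompact {d : ℕ} (z : Euc d) (h : ℝ) : IsCompact (supBall z h) := by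
  have h1 : IsCompact (Metric.closedBall (WithLp.ofLp z) |h|) := isCompact_closedBall _ _
  have h2 := h1.image (PiLp.continuous_toLp 2 (fun _ : Fin d => ℝ))
  refine h2.of_isClosed_subset (supBall_isClosed z h) ?_
  intro x hx
  refine ⟨WithLp.ofLp x, ?_, rfl⟩
  rw [Metric.mem_closedBall, dist_pi_le_iff (abs_nonneg _)]
  intro i
  rw [Real.dist_eq]
  exact (hx i).trans (le_abs_self h)

lemma supBall_mono {d : ℕ} (z : Euc d) {h k : ℝ} (hk : h ≤ k) : supBall z h ⊆ supBall z k :=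
  fun _ hx i => (hx i).trans hk

lemma supBall_sub_open {d : ℕ} {O : Set (Euc d)} (hO : IsOpen O) {x : Euc d} (hx : x ∈ O) :
    ∃ ε > 0, supBall x ε ⊆ O := by
  have h1 : IsOpen ((WithLp.toLp 2 : (Fin d → ℝ) → Euc d) ⁻¹' O) :=
    hO.preimage (PiLp.continuous_toLp 2 (fun _ : Fin d => ℝ))
  obtain ⟨ε, hε, h⟩ := Metric.isOpen_iff.1 h1 (WithLp.ofLp x) hx
  refine ⟨ε / 2, by positivity, fun y hy => ?_⟩
  have : WithLp.ofLp y ∈ Metric.ball (WithLp.ofLp x) ε := by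
    rw [Metric.mem_ball, dist_pi_lt_iff hε]
    intro i
    rw [Real.dist_eq]
    exact (hy i).trans_lt (by linarith)
  exact h this

def ctr {d : ℕ} (c : Euc d) (R h : ℝ) (x : Euc d) : Euc d :=
  WithLp.toLp 2 fun i => max (c i - (R - h)) (min (x i) (c i + (R - h)))

/-- cube of half-side `h` in `Q0 = supBall c R`, as centered at `x` as possible -/
def subc {d : ℕ} (c : Euc d) (R h : ℝ) (x : Euc d) : Set (Euc d) := supBall (ctr c R h x) h

lemma ctr_near {d : ℕ} {c : Euc d} {R h : ℝ} {x : Euc d} (hx : x ∈ supBall c R)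
    (h0 : 0 ≤ h) (hhR : h ≤ R) (i) : |ctr c R h x i - x i| ≤ h := by
  have := hx i
  simp only [ctr]
  rw [abs_le] at *
  rcases max_cases (c i - (R - h)) (min (x i) (c i + (R - h))) with ⟨e, _⟩ | ⟨e, _⟩ <;>
  rcases min_cases (x i) (c i + (R - h)) with ⟨e', _⟩ | ⟨e', _⟩ <;>
  rw [e] <;> try rw [e']
  all_goals constructor <;> linarith

lemma subc_self {d : ℕ} (c : Euc d) (R : ℝ) (x : Euc d) : subc c R R x = supBall c R := by
  have : ctr c R R x = c := by
    ext i; simp [ctr]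
  rw [subc, this]

lemma subc_subset {d : ℕ} {c : Euc d} {R h : ℝ} {x : Euc d} 
    (hhR : h ≤ R) : subc c R h x ⊆ supBall c R := by
  intro y hy i
  have := hy i
  simp only [ctr] at this
  rw [abs_le] at *
  rcases max_cases (c i - (R - h)) (min (x i) (c i + (R - h))) with ⟨e, _⟩ | ⟨e, _⟩ <;>
  rcases min_cases (x i) (c i + (R - h)) with ⟨e', _⟩ | ⟨e', _⟩ <;>
  rw [e] at this <;> try rw [e'] at this
  all_goals constructor <;> linarith

lemma subc_near {d : ℕ} {c : Euc d} {R h : ℝ} {x : Euc d} (hx : x ∈ supBall c R)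
    (h0 : 0 ≤ h) (hhR : h ≤ R) : subc c R h x ⊆ supBall x (2 * h) := by
  intro y hy i
  have := hy i
  have := ctr_near hx h0 hhR i
  rw [abs_le] at *
  constructor <;> linarith

lemma mem_subc {d : ℕ} {c : Euc d} {R H : ℝ} {x y : Euc d} (hx : x ∈ supBall c R)
    (hy : y ∈ supBall c R) (hxy : y ∈ supBall x H) : y ∈ subc c R (min R H) x := by
  intro i
  have h1 := hx i
  have h2 := hy i
  have h3 := hxy i
  simp only [ctr]
  have h4 := abs_nonneg (x i - c i)
  have h5 := abs_nonneg (y i - x i)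
  rw [abs_le] at *
  generalize hm : min R H = m
  have hm' : 0 ≤ m := by rw [← hm]; exact le_min (by linarith) (by linarith)
  rcases max_cases (c i - (R - m)) (min (x i) (c i + (R - m))) with ⟨e, _⟩ | ⟨e, _⟩ <;>
  rcases min_cases (x i) (c i + (R - m)) with ⟨e', _⟩ | ⟨e', _⟩ <;>
  rcases min_cases R H with ⟨e'', _⟩ | ⟨e'', _⟩ <;> rw [hm] at e'' <;>
  rw [e] <;> try rw [e']
  all_goals constructor <;> linarith

lemma doub_pow {d : ℕ} {μ : Measure (Euc d)} {c : ℝ≥0∞}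
    (hdoub : ∀ z h, 0 < h → μ (supBall z (2 * h)) ≤ c * μ (supBall z h)) (n : ℕ) (z : Euc d)
    (h : ℝ) (hh : 0 < h) : μ (supBall z (2 ^ n * h)) ≤ c ^ n * μ (supBall z h) := by
  induction n with
  | zero => simp
  | succ n ih =>
    rw [pow_succ, mul_comm (2 ^ n) 2, mul_assoc]
    refine (hdoub _ _ (by positivity)).trans ?_
    rw [pow_succ, mul_comm (c ^ n) c, mul_assoc]
    gcongr

lemma supBall_pos {d : ℕ} {μ : Measure (Euc d)} {c : ℝ≥0∞}
    (hdoub : ∀ z h, 0 < h → μ (supBall z (2 * h)) ≤ c * μ (supBall z h)) {c0 : Euc d} {R : ℝ}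
    (hpos : μ (supBall c0 R) ≠ 0) (z : Euc d) (hz : z ∈ supBall c0 R)
    {h : ℝ} (hh : 0 < h) : μ (supBall z h) ≠ 0 := by
  intro h0
  obtain ⟨n, hn⟩ := pow_unbounded_of_one_lt (2 * R / h) (one_lt_two : (1:ℝ) < 2)
  have h1 := doub_pow hdoub n z h hh
  rw [h0, mul_zero, nonpos_iff_eq_zero] at h1
  apply hpos
  refine measure_mono_null ?_ h1
  intro y hy i
  rw [div_lt_iff₀ hh] at hn
  have := hy i
  have := hz i
  rw [abs_le] at *
  constructor <;> linarith

lemma covering {d : ℕ} {μ : Measure (Euc d)} [IsLocallyFiniteMeasure μ] {c : ℝ≥0∞}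
    (hdoub : ∀ z h, 0 < h → μ (supBall z (2 * h)) ≤ c * μ (supBall z h)) {c0 : Euc d} {R : ℝ}
    (hR : 0 < R) (hpos : μ (supBall c0 R) ≠ 0) {O : Set (Euc d)} (hO : IsOpen O)
    (hOs : 2 * μ O < μ (supBall c0 R)) :
    ∃ (u : Set (Euc d)) (P W : Euc d → Set (Euc d)), u.Countable ∧
      (∀ x ∈ O ∩ supBall c0 R, ∃ j ∈ u, x ∈ W j) ∧
      (∀ j ∈ u, IsCube (W j) ∧ W j ⊆ supBall c0 R ∧ IsClosed (W j)
        ∧ μ (W j) ≤ c ^ 5 * μ (P j) ∧ μ (P j) ≠ 0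
        ∧ μ (P j) ≠ ∞ ∧ μ (W j) ≠ 0 ∧ μ (P j) ≤ 2 * μ (W j \ O)) ∧
      ∑' j : u, μ (P j) ≤ 2 * μ O := by
  classical
  let hk : ℕ → ℝ := fun k => R / 2 ^ k
  have hkpos : ∀ k, 0 < hk k := fun k => by positivity
  have hkR : ∀ k, hk k ≤ R := fun k => div_le_self hR.le (one_le_pow₀ one_le_two)
  let Q : ℕ → Euc d → Set (Euc d) := fun k x => subc c0 R (hk k) x
  have ctrmem : ∀ x ∈ supBall c0 R, ∀ h, 0 < h → h ≤ R → ctr c0 R h x ∈ supBall c0 R :=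
    fun x hx h h0 hR' => subc_subset (x := x) hR' (fun i => by simp [h0.le])
  have Qpos : ∀ x ∈ supBall c0 R, ∀ h, 0 < h → h ≤ R → μ (subc c0 R h x) ≠ 0 :=
    fun x hx h h0 hR' => supBall_pos hdoub hpos _ (ctrmem x hx h h0 hR') h0
  have Qfin : ∀ x h, μ (subc c0 R h x) ≠ ∞ := fun x h => (supBall_isCompact _ _).measure_ne_top
  have hex : ∀ x ∈ O ∩ supBall c0 R, ∃ k, μ (Q k x) < 2 * μ (Q k x ∩ O) := by
    intro x hx
    obtain ⟨ε, hε, hsub⟩ := supBall_sub_open hO hx.1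
    obtain ⟨n, hn⟩ := pow_unbounded_of_one_lt (2 * R / ε) (one_lt_two : (1:ℝ) < 2)
    refine ⟨n, ?_⟩
    have h1 : Q n x ⊆ O := by
      refine (subc_near hx.2 (hkpos _).le (hkR n)).trans ((supBall_mono _ ?_).trans hsub)
      simp only [hk]
      rw [div_lt_iff₀ hε] at hn
      rw [← mul_div_assoc, div_le_iff₀ (by positivity)]
      linarith
    rw [inter_eq_left.2 h1, two_mul]
    exact ENNReal.lt_add_right (Qfin _ _) (Qpos x hx.2 _ (hkpos n) (hkR n))
  have hex' : ∀ x, ∃ k, x ∈ O ∩ supBall c0 R → (μ (Q (k+1) x) < 2 * μ (Q (k+1) x ∩ O) ∧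
      2 * μ (Q k x ∩ O) ≤ μ (Q k x)) := by
    intro x
    by_cases hx : x ∈ O ∩ supBall c0 R
    · have h1 := Nat.find_spec (hex x hx)
      have h2 : Nat.find (hex x hx) ≠ 0 := by
        intro h0
        rw [h0] at h1
        have : Q 0 x = supBall c0 R := by simp [Q, hk, subc_self]
        rw [this] at h1
        refine absurd (h1.trans_le ?_) (not_lt.2 hOs.le)
        gcongr
        exact inter_subset_right
      obtain ⟨k, hk'⟩ := Nat.exists_eq_succ_of_ne_zero h2
      refine ⟨k, fun _ => ⟨by rw [hk'] at h1; exact h1, ?_⟩⟩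
      exact not_lt.1 (Nat.find_min (hex x hx) (by omega))
    · exact ⟨0, fun h => absurd h hx⟩
  choose K hK using hex'
  let δ : Euc d → ℝ := fun x => hk (K x + 1)
  have hδ2 : ∀ x, 2 * δ x = hk (K x) := fun x => by simp only [δ, hk, pow_succ]; field_simp
  let P : Euc d → Set (Euc d) := fun x => Q (K x + 1) x
  let W : Euc d → Set (Euc d) := fun x => subc c0 R (min R (8 * δ x)) x
  obtain ⟨u, hut, hdis, hcov⟩ := Vitali.exists_disjoint_subfamily_covering_enlargement P
    (O ∩ supBall c0 R) δ 2 one_lt_two (fun x _ => (hkpos _).le) R (fun x _ => hkR _)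
    (fun x hx => nonempty_of_measure_ne_zero (Qpos x hx.2 _ (hkpos _) (hkR _)))
  have hPm : ∀ j, MeasurableSet (P j) := fun j => (supBall_isClosed _ _).measurableSet
  have hucount : u.Countable := by
    refine hdis.countable_of_nonempty_interior fun x hx => ?_
    refine ⟨ctr c0 R (δ x) x, ?_⟩
    rw [mem_interior]
    refine ⟨{y | ∀ i, |y i - ctr c0 R (δ x) x i| < δ x}, fun y hy i => (hy i).le, ?_, fun i => ?_⟩
    · simp only [ofPred_forall]
      exact isOpen_iInter_of_finite fun i => isOpen_lt (by fun_prop) continuous_const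
    · simpa using hkpos _
  refine ⟨u, P, W, hucount, ?_, ?_, ?_⟩
  · intro x hx
    obtain ⟨j, hj, ⟨y, hy1, hy2⟩, hle⟩ := hcov x hx
    refine ⟨j, hj, mem_subc (hut hj).2 hx.2 fun i => ?_⟩
    have h1 := subc_near hx.2 (hkpos _).le (hkR _) hy1 i
    have h2 := subc_near (hut hj).2 (hkpos _).le (hkR _) hy2 i
    change |y i - x i| ≤ 2 * δ x at h1
    change |y i - j i| ≤ 2 * δ j at h2
    have := hkpos (K j + 1)
    change 0 < δ j at this
    rw [abs_le] at *
    constructor <;> linarith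
  · intro j hj
    have hδ : 0 < δ j := hkpos _
    have hm : 0 < min R (8 * δ j) := lt_min hR (by positivity)
    have hj2 := (hut hj).2
    have hPpos : μ (P j) ≠ 0 := Qpos j hj2 _ (hkpos _) (hkR _)
    refine ⟨supBall_isCube _ hm, subc_subset (min_le_left _ _), supBall_isClosed _ _, ?_, hPpos,
      Qfin _ _, Qpos j hj2 _ hm (min_le_left _ _), ?_⟩
    · refine le_trans (measure_mono ?_) (doub_pow hdoub 5 (ctr c0 R (δ j) j) (δ j) hδ)
      intro y hy i
      have h1 := subc_near hj2 hm.le (min_le_left _ _) hy i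
      have h2 := ctr_near hj2 (hkpos _).le (hkR (K j + 1)) i
      change |ctr c0 R (δ j) j i - j i| ≤ δ j at h2
      have h3 := min_le_right R (8 * δ j)
      rw [abs_le] at *
      constructor <;> linarith
    · have hQW : Q (K j) j ⊆ W j := by
        intro y hy
        refine mem_subc hj2 (subc_subset (hkR _) hy) ?_
        refine supBall_mono _ ?_ (subc_near hj2 (hkpos _).le (hkR _) hy)
        rw [← hδ2]; linarith
      have hPQ : P j ⊆ Q (K j) j := by
        intro y hy
        have := mem_subc (H := hk (K j)) hj2 (subc_subset (hkR _) hy) (by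
          rw [← hδ2]; exact subc_near hj2 (hkpos _).le (hkR _) hy)
        rwa [min_eq_right (hkR _)] at this
      have h2 := (hK j (hut hj)).2
      have h3 : μ (Q (K j) j) = μ (Q (K j) j ∩ O) + μ (Q (K j) j \ O) :=
        (measure_inter_add_sdiff _ hO.measurableSet).symm
      have h4 : μ (Q (K j) j ∩ O) ≤ μ (Q (K j) j \ O) := by
        rw [h3, two_mul] at h2
        refine (ENNReal.add_le_add_iff_left ?_).1 h2
        exact measure_ne_top_of_subset inter_subset_left (Qfin _ _)
      calc μ (P j) ≤ μ (Q (K j) j) := measure_mono hPQ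
        _ ≤ 2 * μ (Q (K j) j \ O) := by rw [h3, two_mul]; gcongr
        _ ≤ 2 * μ (W j \ O) := by gcongr
  · have : Countable u := hucount.to_subtype
    calc ∑' j : u, μ (P j) ≤ ∑' j : u, 2 * μ (P j ∩ O) :=
          ENNReal.tsum_le_tsum fun j => (hK j (hut j.2)).1.le
      _ = 2 * μ (⋃ j : u, P j ∩ O) := by
          rw [ENNReal.tsum_mul_left, measure_iUnion]
          · intro i j hij
            exact (hdis i.2 j.2 (fun h => hij (Subtype.ext h))).mono inter_subset_left
              inter_subset_left
          · exact fun j => (hPm j).inter hO.measurableSet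
      _ ≤ 2 * μ O := by
          gcongr
          exact iUnion_subset fun j => inter_subset_right

lemma rearr_le {α : Type*} [MeasurableSpace α] {ν : Measure α} {g : α → ℝ≥0∞} {t : ℝ} {l : ℝ≥0∞}
    (h : ν {x | l < g x} ≤ ENNReal.ofReal t) : rearr ν g t ≤ l := sInf_le h

lemma rearr_spec {α : Type*} [MeasurableSpace α] (ν : Measure α) (g : α → ℝ≥0∞) (t : ℝ) :
    ν {x | rearr ν g t < g x} ≤ ENNReal.ofReal t := by
  have hne : {l : ℝ≥0∞ | ν {x | l < g x} ≤ ENNReal.ofReal t}.Nonempty := ⟨∞, by simp⟩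
  obtain ⟨u, hu, hlim, hmem⟩ := exists_seq_tendsto_sInf hne (OrderBot.bddBelow _)
  have hsub : {x | rearr ν g t < g x} ⊆ ⋃ n, {x | u n < g x} := by
    intro x hx
    obtain ⟨n, hn⟩ := (hlim.eventually_lt_const hx).exists
    exact mem_iUnion.2 ⟨n, hn⟩
  have hmono : Monotone fun n => {x | u n < g x} := fun m n hmn x hx => (hu hmn).trans_lt hx
  refine (measure_mono hsub).trans ?_
  rw [hmono.measure_iUnion]
  exact iSup_le fun n => hmem n

lemma rearr_anti {α : Type*} [MeasurableSpace α] (ν : Measure α) (g : α → ℝ≥0∞) :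
    Antitone (rearr ν g) := fun _ _ hst =>
  rearr_le ((rearr_spec ν g _).trans (ENNReal.ofReal_le_ofReal hst))

lemma cheb {α : Type*} [MeasurableSpace α] {ν : Measure α} {g : α → ℝ≥0∞} (hg : AEMeasurable g ν)
    {F V K : ℝ≥0∞} (hK0 : K ≠ 0) (hK : K ≠ ∞) (h : ∫⁻ x, g x ∂ν ≤ F * V) :
    ν {x | K * F < g x} ≤ V / K := by
  rcases eq_or_ne F 0 with rfl | hF0
  · rw [zero_mul, nonpos_iff_eq_zero, lintegral_eq_zero_iff' hg] at h
    have : ν {x | K * 0 < g x} = 0 := by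
      rw [← nonpos_iff_eq_zero]
      have h2 := ae_iff.1 h
      simpa [pos_iff_ne_zero] using h2.le
    rw [this]; exact zero_le
  rcases eq_or_ne F ∞ with rfl | hFt
  · simp [ENNReal.mul_top hK0]
  calc ν {x | K * F < g x} ≤ ν {x | K * F ≤ g x} := by
        apply measure_mono
        intro x hx
        exact le_of_lt (show K * F < g x from hx)
    _ ≤ (∫⁻ x, g x ∂ν) / (K * F) := meas_ge_le_lintegral_div hg (mul_ne_zero hK0 hF0)
        (ENNReal.mul_ne_top hK hFt)
    _ ≤ F * V / (F * K) := by rw [mul_comm K F]; gcongr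
    _ = V / K := ENNReal.mul_div_mul_left _ _ hF0 hFt

lemma osc_le {d : ℕ} {μ : Measure (Euc d)} {Q0 Q : Set (Euc d)} {f : Euc d → ℝ}
    (hf : Integrable f (μ.restrict Q0)) (hQ : IsCube Q) (hQQ : Q ⊆ Q0) (h0 : μ Q ≠ 0)
    (hfin : μ Q ≠ ∞) {x : Euc d} (hx : x ∈ Q) :
    ∫⁻ y in Q, ENNReal.ofReal |f y - ⨍ z in Q, f z ∂μ| ∂μ ≤ sharpLocal μ Q0 f x * μ Q := by
  have h1 : ENNReal.ofReal (⨍ y in Q, |f y - ⨍ z in Q, f z ∂μ| ∂μ) ≤ sharpLocal μ Q0 f x :=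
    le_iSup₂_of_le Q ⟨hQ, hx, hQQ⟩ le_rfl
  have hfQ : Integrable f (μ.restrict Q) := hf.mono_measure (Measure.restrict_mono_set _ hQQ)
  have : IsFiniteMeasure (μ.restrict Q) := ⟨by simpa using hfin.lt_top⟩
  have h2 : Integrable (fun y => |f y - ⨍ z in Q, f z ∂μ|) (μ.restrict Q) :=
    (hfQ.sub (integrable_const _)).abs
  rw [← ofReal_integral_eq_lintegral_ofReal h2 (Eventually.of_forall fun _ => abs_nonneg _)]
  calc _ = ENNReal.ofReal (⨍ y in Q, |f y - ⨍ z in Q, f z ∂μ| ∂μ) * μ Q := by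
        generalize (⨍ z in Q, f z ∂μ) = w
        rw [setAverage_eq, smul_eq_mul, ENNReal.ofReal_mul (by positivity),
          mul_comm, ← mul_assoc,
          ENNReal.ofReal_inv_of_pos, ofReal_measureReal, ENNReal.mul_inv_cancel h0 hfin, one_mul]
        exact ENNReal.toReal_pos h0 hfin
    _ ≤ _ := by gcongr

lemma step {d : ℕ} {μ : Measure (Euc d)} [IsLocallyFiniteMeasure μ] [μ.Regular] {c : ℝ≥0∞}
    (hc : c ≠ ∞)
    (hdoub : ∀ z h, 0 < h → μ (supBall z (2 * h)) ≤ c * μ (supBall z h)) {c0 : Euc d} {R : ℝ}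
    (hR : 0 < R) {f : Euc d → ℝ} (hfm : Measurable f) (hf : Integrable f (μ.restrict (supBall c0 R)))
    (t : ℝ) (ht : 0 < t) :
    rearrR (μ.restrict (supBall c0 R)) (fun x => f x - ⨍ z in supBall c0 R, f z ∂μ) t ≤
      rearrR (μ.restrict (supBall c0 R)) (fun x => f x - ⨍ z in supBall c0 R, f z ∂μ) (2 * t) +
      (16 * (c ^ 5 + 1)) *
        rearr (μ.restrict (supBall c0 R)) (sharpLocal μ (supBall c0 R) f) t := by
  set Q0 := supBall c0 R with hQ0
  have hQm : MeasurableSet Q0 := (supBall_isClosed _ _).measurableSet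
  have hQfin : μ Q0 ≠ ∞ := (supBall_isCompact _ _).measure_ne_top
  set S := sharpLocal μ Q0 f with hS
  set F := rearr (μ.restrict Q0) S t with hF
  set a := ⨍ z in Q0, f z ∂μ with ha
  set D : ℝ≥0∞ := c ^ 5 + 1 with hD
  have hDt : D ≠ ∞ := by simp [hD, hc]
  have hD1 : 1 ≤ D := le_add_self
  by_cases hM : μ Q0 ≤ ENNReal.ofReal t
  · have : rearrR (μ.restrict Q0) (fun x => f x - a) t ≤ 0 := by
      refine rearr_le (le_trans (measure_mono (subset_univ _)) ?_)
      simpa using hM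
    exact this.trans zero_le
  push Not at hM
  have hQ0pos : μ Q0 ≠ 0 := (lt_of_le_of_lt zero_le hM).ne'
  have htpos : ENNReal.ofReal t ≠ 0 := by simpa using ht
  by_cases hM8 : μ Q0 ≤ 8 * ENNReal.ofReal t
  · refine le_trans ?_ le_add_self
    have h1 : ∫⁻ x, ENNReal.ofReal |f x - a| ∂(μ.restrict Q0) ≤ F * μ Q0 := by
      have hex : ∃ x ∈ Q0, S x ≤ F := by
        by_contra! hcon
        have := rearr_spec (μ.restrict Q0) S t
        rw [Measure.restrict_apply' hQm] at this
        refine absurd (this.trans_lt hM) (not_lt.2 (measure_mono fun x hx => ⟨hcon x hx, hx⟩))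
      obtain ⟨x, hx, hxF⟩ := hex
      refine (osc_le hf (supBall_isCube _ hR) Subset.rfl hQ0pos hQfin hx).trans ?_
      gcongr
    have h2 := cheb (K := 8) (by fun_prop) (by norm_num) (by norm_num) h1
    have h3 : rearrR (μ.restrict Q0) (fun x => f x - a) t ≤ 8 * F := by
      refine rearr_le (h2.trans ?_)
      exact ENNReal.div_le_of_le_mul' hM8
    refine h3.trans ?_
    gcongr
    calc (8 : ℝ≥0∞) ≤ 16 * 1 := by norm_num
      _ ≤ 16 * D := by gcongr
  push Not at hM8
  set G2 := rearrR (μ.restrict Q0) (fun x => f x - a) (2 * t) with hG2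
  set g : Euc d → ℝ≥0∞ := fun x => ENNReal.ofReal |f x - a| with hg
  have hE1 : μ ({x | G2 < g x} ∩ Q0) ≤ 2 * ENNReal.ofReal t := by
    have := rearr_spec (μ.restrict Q0) g (2 * t)
    rw [Measure.restrict_apply' hQm, ENNReal.ofReal_mul (by norm_num)] at this
    simp only [ENNReal.ofReal_ofNat] at this
    exact this
  have hE2 : μ ({x | F < S x} ∩ Q0) ≤ ENNReal.ofReal t := by
    have := rearr_spec (μ.restrict Q0) S t
    rwa [Measure.restrict_apply' hQm] at this
  have hE : μ (({x | G2 < g x} ∩ Q0) ∪ ({x | F < S x} ∩ Q0)) < 4 * ENNReal.ofReal t := by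
    refine (measure_union_le _ _).trans_lt ((add_le_add hE1 hE2).trans_lt ?_)
    have : (4 : ℝ≥0∞) * ENNReal.ofReal t = (2 * ENNReal.ofReal t + ENNReal.ofReal t)
        + ENNReal.ofReal t := by ring
    rw [this]
    exact ENNReal.lt_add_right (by finiteness) htpos
  obtain ⟨O, hEO, hOo, hOlt⟩ := Set.exists_isOpen_lt_of_lt _ _ hE
  have hO2 : 2 * μ O < μ Q0 := by
    refine lt_of_le_of_lt ?_ hM8
    calc 2 * μ O ≤ 2 * (4 * ENNReal.ofReal t) := by gcongr
      _ = 8 * ENNReal.ofReal t := by rw [← mul_assoc]; norm_num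
  obtain ⟨u, P, W, hucount, hcov, hprop, hsum⟩ := covering hdoub hR hQ0pos hOo hO2
  set K : ℝ≥0∞ := 8 * D with hK
  have hK0 : K ≠ 0 := mul_ne_zero (by norm_num) (lt_of_lt_of_le zero_lt_one hD1).ne'
  have hKt : K ≠ ∞ := by finiteness
  let w : Euc d → ℝ := fun j => ⨍ z in W j, f z ∂μ
  let Bd : Euc d → Set (Euc d) := fun j => {x | K * F < ENNReal.ofReal |f x - w j|} ∩ W j
  have hout : ∀ y ∈ Q0, y ∉ O → g y ≤ G2 ∧ S y ≤ F := by
    intro y hy hyO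
    constructor
    · by_contra! hh
      exact hyO (hEO (Or.inl ⟨hh, hy⟩))
    · by_contra! hh
      exact hyO (hEO (Or.inr ⟨hh, hy⟩))
  have hBd : ∀ j ∈ u, μ (Bd j) ≤ μ (P j) / 8 := by
    intro j hj
    obtain ⟨hcube, hsub, hcl, hWP, hP0, hPt, hW0, hPW⟩ := hprop j hj
    have hWt : μ (W j) ≠ ∞ := measure_ne_top_of_subset hsub hQfin
    have hne : (W j \ O).Nonempty := by
      refine nonempty_of_measure_ne_zero (μ := μ) fun h0 => hP0 ?_
      simpa [h0] using hPW
    obtain ⟨y, hyW, hyO⟩ := hne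
    have h1 := (osc_le hf hcube hsub hW0 hWt hyW).trans
      (mul_le_mul_left (hout y (hsub hyW) hyO).2 _)
    have h2 := cheb (by fun_prop) hK0 hKt h1
    rw [Measure.restrict_apply' hcl.measurableSet] at h2
    refine h2.trans ?_
    refine ENNReal.div_le_of_le_mul ?_
    calc μ (W j) ≤ c ^ 5 * μ (P j) := hWP
      _ ≤ D * μ (P j) := by gcongr; exact le_self_add
      _ = μ (P j) / 8 * K := by
        rw [hK, ← mul_assoc, ENNReal.div_mul_cancel (by norm_num) (by norm_num), mul_comm]
  have hpt : ∀ j ∈ u, ∀ x ∈ W j, x ∉ Bd j → g x ≤ G2 + 2 * (K * F) := by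
    intro j hj x hxW hxB
    obtain ⟨hcube, hsub, hcl, hWP, hP0, hPt, hW0, hPW⟩ := hprop j hj
    have hex : ∃ y ∈ W j \ O, y ∉ Bd j := by
      by_contra! hcon
      have h1 : μ (W j \ O) ≤ μ (P j) / 8 := (measure_mono hcon).trans (hBd j hj)
      have h2 : μ (P j) ≤ 2 * (μ (P j) / 8) := hPW.trans (by gcongr)
      have h3 : 2 * (μ (P j) / 8) < μ (P j) := by
        rw [← mul_div_assoc]
        refine ENNReal.div_lt_of_lt_mul ?_
        rw [mul_comm]
        exact (ENNReal.mul_lt_mul_iff_right hP0 hPt).2 (by norm_num)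
      exact absurd h2 (not_le.2 h3)
    obtain ⟨y, ⟨hyW, hyO⟩, hyB⟩ := hex
    have hx' : ENNReal.ofReal |f x - w j| ≤ K * F := by
      by_contra! hh; exact hxB ⟨hh, hxW⟩
    have hy' : ENNReal.ofReal |f y - w j| ≤ K * F := by
      by_contra! hh; exact hyB ⟨hh, hyW⟩
    have hgy := (hout y (hsub hyW) hyO).1
    calc g x ≤ ENNReal.ofReal (|f y - a| + |f x - w j| + |f y - w j|) := by
          apply ENNReal.ofReal_le_ofReal
          have e : f x - a = (f y - a) + (f x - w j) - (f y - w j) := by ring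
          rw [e]
          exact (abs_sub _ _).trans (by gcongr; exact abs_add_le _ _)
      _ = g y + ENNReal.ofReal |f x - w j| + ENNReal.ofReal |f y - w j| := by
          rw [ENNReal.ofReal_add (by positivity) (by positivity),
            ENNReal.ofReal_add (by positivity) (by positivity)]
      _ ≤ G2 + K * F + K * F := by gcongr
      _ = G2 + 2 * (K * F) := by ring
  have hKK : 2 * (K * F) = 16 * D * F := by
    rw [hK, ← mul_assoc, ← mul_assoc]; norm_num
  rw [← hKK]
  refine rearr_le ?_
  rw [Measure.restrict_apply' hQm]
  have hsub2 : {x | G2 + 2 * (K * F) < g x} ∩ Q0 ⊆ ⋃ j : u, Bd j := by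
    intro x ⟨hx1, hx2⟩
    have hxO : x ∈ O := hEO (Or.inl ⟨(lt_of_le_of_lt le_self_add hx1 : G2 < g x), hx2⟩)
    obtain ⟨j, hj, hxj⟩ := hcov x ⟨hxO, hx2⟩
    refine mem_iUnion.2 ⟨⟨j, hj⟩, ?_⟩
    by_contra hcon
    exact absurd (hpt j hj x hxj hcon) (not_le.2 hx1)
  have : Countable u := hucount.to_subtype
  calc _ ≤ μ (⋃ j : u, Bd j) := measure_mono hsub2
    _ ≤ ∑' j : u, μ (Bd j) := measure_iUnion_le _
    _ ≤ ∑' j : u, μ (P j) / 8 := ENNReal.tsum_le_tsum fun j => hBd j j.2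
    _ = (∑' j : u, μ (P j)) / 8 := by simp_rw [div_eq_mul_inv]; rw [ENNReal.tsum_mul_right]
    _ ≤ ENNReal.ofReal t := by
        refine ENNReal.div_le_of_le_mul' (hsum.trans ?_)
        calc 2 * μ O ≤ 2 * (4 * ENNReal.ofReal t) := by gcongr
          _ = 8 * ENNReal.ofReal t := by rw [← mul_assoc]; norm_num

lemma iter_step {A : ℝ≥0∞} {G F : ℝ → ℝ≥0∞} (hstep : ∀ t, 0 < t → G t ≤ G (2 * t) + A * F t)
    {u : ℝ} (hu : 0 < u) (n : ℕ) :
    G u ≤ G (2 ^ n * u) + A * ∑ k ∈ Finset.range n, F (2 ^ k * u) := by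
  induction n with
  | zero => simp
  | succ n ih =>
    refine ih.trans ?_
    have h := hstep (2 ^ n * u) (by positivity)
    rw [Finset.sum_range_succ, mul_add]
    calc _ ≤ (G (2 * (2 ^ n * u)) + A * F (2 ^ n * u)) +
          A * ∑ k ∈ Finset.range n, F (2 ^ k * u) := by gcongr
      _ = _ := by
        rw [pow_succ, mul_comm (2 ^ n) 2, mul_assoc, add_assoc, add_comm (A * F _)]

/-- truncated weighted function -/
def phi (p t : ℝ) (F : ℝ → ℝ≥0∞) (v : ℝ) : ℝ≥0∞ :=
  if v < t then ENNReal.ofReal (v ^ (1 / p)) * F v else 0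

lemma tail_bound {A : ℝ≥0∞} {G F : ℝ → ℝ≥0∞} (hstep : ∀ t, 0 < t → G t ≤ G (2 * t) + A * F t)
    (hF : Antitone F) {M : ℝ} (hzero : ∀ t, M ≤ t → G t = 0) {t : ℝ} (ht : 0 < t) (ht1 : t < 1) :
    G t ≤ A * (ENNReal.ofReal (1 + (|Real.log M| + 1) / Real.log 2) *
      (ENNReal.ofReal (1 - Real.log t) * F t)) := by
  have hl2 : 0 < Real.log 2 := Real.log_pos one_lt_two
  have hlt : Real.log t < 0 := Real.log_neg ht ht1
  have hx : 0 ≤ (|Real.log M| - Real.log t) / Real.log 2 := by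
    apply div_nonneg _ hl2.le
    have := abs_nonneg (Real.log M)
    linarith
  obtain ⟨m, hm⟩ : ∃ m, m = ⌈(|Real.log M| - Real.log t) / Real.log 2⌉₊ := ⟨_, rfl⟩
  have hm1 : (|Real.log M| - Real.log t) / Real.log 2 ≤ m := hm ▸ Nat.le_ceil _
  have hm2 : (m : ℝ) < (|Real.log M| - Real.log t) / Real.log 2 + 1 := hm ▸ Nat.ceil_lt_add_one hx
  have hM : M ≤ 2 ^ m * t := by
    rcases le_or_gt M 0 with h | h
    · exact h.trans (by positivity)
    · rw [← Real.log_le_log_iff h (by positivity), Real.log_mul (by positivity) ht.ne', Real.log_pow]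
      rw [div_le_iff₀ hl2] at hm1
      have := le_abs_self (Real.log M)
      linarith
  have hmB : (m : ℝ) ≤ (1 + (|Real.log M| + 1) / Real.log 2) * (1 - Real.log t) := by
    refine hm2.le.trans ?_
    have h1 := abs_nonneg (Real.log M)
    rw [div_add_one hl2.ne', one_add_div hl2.ne', div_mul_eq_mul_div]
    gcongr
    nlinarith [mul_nonneg h1 (neg_nonneg.2 hlt.le), mul_nonneg hl2.le (neg_nonneg.2 hlt.le)]
  have h1 := iter_step hstep ht m
  rw [hzero _ hM, zero_add] at h1
  refine h1.trans ?_
  gcongr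
  calc ∑ k ∈ Finset.range m, F (2 ^ k * t) ≤ ∑ k ∈ Finset.range m, F t := by
        gcongr with k hk
        exact hF (le_mul_of_one_le_left ht.le (one_le_pow₀ one_le_two))
    _ = ENNReal.ofReal m * F t := by simp
    _ ≤ ENNReal.ofReal ((1 + (|Real.log M| + 1) / Real.log 2) * (1 - Real.log t)) * F t := by
        gcongr
    _ = _ := by rw [ENNReal.ofReal_mul (by positivity), mul_assoc]

lemma pointwise {A : ℝ≥0∞} {G F : ℝ → ℝ≥0∞} (hstep : ∀ t, 0 < t → G t ≤ G (2 * t) + A * F t)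
    (hF : Antitone F) (hG : Antitone G) {M : ℝ} (hzero : ∀ t, M ≤ t → G t = 0) {p : ℝ} (hp : 1 < p)
    {t : ℝ} (ht : 0 < t) (ht1 : t < 1) {u : ℝ} (hu : 0 < u)
    (hut : u < t * (1 - Real.log t) ^ (-p)) :
    ENNReal.ofReal (u ^ (1 / p)) * G u ≤
      (A * (∑' k : ℕ, ENNReal.ofReal ((2 : ℝ) ^ (-(1 / (2 * p)))) ^ k) +
        A * ENNReal.ofReal (1 + (|Real.log M| + 1) / Real.log 2)) *
      ((⨆ k : ℕ, ENNReal.ofReal ((2 : ℝ) ^ (-(1 / (2 * p)))) ^ k * phi p t F (2 ^ k * u)) ⊔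
        phi p t F ((1 - Real.log t) ^ p * u)) := by
  have hlt : Real.log t < 0 := Real.log_neg ht ht1
  have hL : 1 ≤ 1 - Real.log t := by linarith
  have hL0 : 0 < 1 - Real.log t := by linarith
  have hp0 : 0 < p := by linarith
  set q : ℝ := (2 : ℝ) ^ (-(1 / (2 * p))) with hq
  have hq0 : 0 < q := by positivity
  have hκ : (1 - Real.log t) ^ p * u < t := by
    rw [Real.rpow_neg hL0.le, ← div_eq_mul_inv, lt_div_iff₀ (by positivity)] at hut
    linarith
  have hex : ∃ n : ℕ, t ≤ 2 ^ n * u := by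
    obtain ⟨n, hn⟩ := pow_unbounded_of_one_lt (t / u) (one_lt_two : (1:ℝ) < 2)
    exact ⟨n, ((div_lt_iff₀ hu).1 hn).le⟩
  classical
  set n := Nat.find hex
  have hn : t ≤ 2 ^ n * u := Nat.find_spec hex
  have hn' : ∀ k < n, 2 ^ k * u < t := fun k hk => not_le.1 (Nat.find_min hex hk)
  have h1 := iter_step hstep hu n
  have h2 : G (2 ^ n * u) ≤ _ := (hG hn).trans (tail_bound hstep hF hzero ht ht1)
  have h3 := h1.trans (add_le_add_left h2 _)
  set X := ⨆ k : ℕ, ENNReal.ofReal q ^ k * phi p t F (2 ^ k * u) with hX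
  set Y := phi p t F ((1 - Real.log t) ^ p * u) with hY
  have e1 : ENNReal.ofReal (u ^ (1 / p)) * ∑ k ∈ Finset.range n, F (2 ^ k * u) ≤
      (∑' k : ℕ, ENNReal.ofReal q ^ k) * X := by
    rw [Finset.mul_sum, ← ENNReal.tsum_mul_right]
    refine le_trans (Finset.sum_le_sum ?_) (ENNReal.sum_le_tsum (Finset.range n))
    intro k hk
    have hk' := hn' k (Finset.mem_range.1 hk)
    refine le_trans (le_of_eq ?_) (mul_le_mul_right
      (le_iSup (fun k : ℕ => ENNReal.ofReal q ^ k * phi p t F (2 ^ k * u)) k) _)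
    simp only [phi, if_pos hk']
    rw [← mul_assoc, ← mul_assoc, ← ENNReal.ofReal_pow hq0.le, ← ENNReal.ofReal_mul (by positivity),
      ← ENNReal.ofReal_mul (by positivity)]
    congr 2
    rw [Real.mul_rpow (by positivity) hu.le, ← mul_assoc, ← mul_pow]
    have : q * q = (2 : ℝ) ^ (-(1 / p)) := by
      rw [hq, ← Real.rpow_add two_pos]; congr 1; field_simp; norm_num
    rw [this, ← Real.rpow_natCast, ← Real.rpow_natCast, ← Real.rpow_mul two_pos.le,
      ← Real.rpow_mul two_pos.le, ← Real.rpow_add two_pos]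
    have : -(1 / p) * (k : ℝ) + k * (1 / p) = 0 := by ring
    rw [this, Real.rpow_zero, one_mul]
  have e2 : ENNReal.ofReal (u ^ (1 / p)) * (ENNReal.ofReal (1 - Real.log t) * F t) ≤ Y := by
    simp only [hY, phi, if_pos hκ]
    rw [← mul_assoc, ← ENNReal.ofReal_mul (by positivity)]
    have : u ^ (1 / p) * (1 - Real.log t) = ((1 - Real.log t) ^ p * u) ^ (1 / p) := by
      rw [Real.mul_rpow (by positivity) hu.le, ← Real.rpow_mul hL0.le, mul_one_div_cancel hp0.ne',
        Real.rpow_one, mul_comm]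
    rw [this]
    gcongr
    exact hF hκ.le
  generalize ENNReal.ofReal (1 + (|Real.log M| + 1) / Real.log 2) = B at *
  generalize ENNReal.ofReal (1 - Real.log t) * F t = Z at *
  generalize (∑' k : ℕ, ENNReal.ofReal q ^ k) = T at *
  generalize ∑ k ∈ Finset.range n, F (2 ^ k * u) = V at *
  generalize ENNReal.ofReal (u ^ (1 / p)) = U at *
  calc U * G u ≤ U * (A * (B * Z) + A * V) := by gcongr
    _ = A * B * (U * Z) + A * (U * V) := by ring
    _ ≤ A * B * Y + A * (T * X) := by gcongr
    _ ≤ A * B * (X ⊔ Y) + A * (T * (X ⊔ Y)) := by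
        gcongr
        · exact le_sup_right
        · exact le_sup_left
    _ = _ := by ring

lemma scale (ψ : ℝ → ℝ≥0∞) {s : ℝ} (hs : 0 < s) :
    ∫⁻ u in Ioi (0:ℝ), ψ (s * u) / ENNReal.ofReal u = ∫⁻ v in Ioi (0:ℝ), ψ v / ENNReal.ofReal v := by
  have himg : (fun u : ℝ => s * u) '' Ioi 0 = Ioi 0 := by
    rw [image_mul_left_Ioi hs, mul_zero]
  have h := lintegral_image_eq_lintegral_abs_deriv_mul (f := fun u : ℝ => s * u)
    (f' := fun _ => s) (s := Ioi 0) measurableSet_Ioi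
    (fun x _ => by simpa using ((hasDerivAt_id x).const_mul s).hasDerivWithinAt)
    (fun x _ y _ h => mul_left_cancel₀ hs.ne' h) (fun v => ψ v / ENNReal.ofReal v)
  rw [himg] at h
  rw [h]
  refine setLIntegral_congr_fun measurableSet_Ioi fun u hu => ?_
  have hu0 : ENNReal.ofReal s ≠ 0 := by simpa using hs
  simp only [abs_of_pos hs]
  rw [ENNReal.ofReal_mul hs.le, ← mul_div_assoc, ENNReal.mul_div_mul_left _ _ hu0 (by simp)]

lemma final (A : ℝ≥0∞) (hA : A ≠ ∞) (M p : ℝ) (hp : 1 < p) (r : ℝ≥0∞) (hr : 0 < r) :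
    ∃ C : ℝ, 0 < C ∧ ∀ G F : ℝ → ℝ≥0∞, Antitone G → Antitone F →
      (∀ t, 0 < t → G t ≤ G (2 * t) + A * F t) → (∀ t, M ≤ t → G t = 0) →
      ∀ t ∈ Set.Ioo (0 : ℝ) 1,
        qint r (Set.Ioo 0 (t * (1 - Real.log t) ^ (-p)))
            (fun u => ENNReal.ofReal (u ^ (1 / p)) * G u) ≤
          ENNReal.ofReal C * qint r (Set.Ioo 0 t) (fun u => ENNReal.ofReal (u ^ (1 / p)) * F u) := by
  have hp0 : 0 < p := by linarith
  set q : ℝ≥0∞ := ENNReal.ofReal ((2 : ℝ) ^ (-(1 / (2 * p)))) with hq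
  have hq1 : q < 1 := by
    rw [hq, ENNReal.ofReal_lt_one]
    exact Real.rpow_lt_one_of_one_lt_of_neg one_lt_two (by rw [neg_lt_zero]; positivity)
  have hgeo : ∀ x : ℝ≥0∞, x < 1 → ∑' k : ℕ, x ^ k ≠ ∞ := by
    intro x hx
    rw [ENNReal.tsum_geometric, Ne, ENNReal.inv_eq_top, tsub_eq_zero_iff_le]
    exact not_le.2 hx
  set C2 : ℝ≥0∞ := A * (∑' k : ℕ, q ^ k) +
        A * ENNReal.ofReal (1 + (|Real.log M| + 1) / Real.log 2) with hC2
  have hC2t : C2 ≠ ∞ := by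
    have := hgeo q hq1
    finiteness
  suffices h : ∃ C : ℝ≥0∞, C ≠ ∞ ∧ ∀ G F : ℝ → ℝ≥0∞, Antitone G → Antitone F →
      (∀ t, 0 < t → G t ≤ G (2 * t) + A * F t) → (∀ t, M ≤ t → G t = 0) →
      ∀ t ∈ Set.Ioo (0 : ℝ) 1,
        qint r (Set.Ioo 0 (t * (1 - Real.log t) ^ (-p)))
            (fun u => ENNReal.ofReal (u ^ (1 / p)) * G u) ≤
          C * qint r (Set.Ioo 0 t) (fun u => ENNReal.ofReal (u ^ (1 / p)) * F u) by
    obtain ⟨C, hC, h⟩ := h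
    refine ⟨C.toReal + 1, by positivity, fun G F hG hF h1 h2 t ht => (h G F hG hF h1 h2 t ht).trans ?_⟩
    gcongr
    rw [ENNReal.le_ofReal_iff_toReal_le hC (by positivity)]
    linarith
  rcases eq_or_ne r ∞ with rfl | hrt
  · refine ⟨C2, hC2t, fun G F hG hF hstep hzero t ht => ?_⟩
    simp only [qint, if_true]
    refine iSup₂_le fun u hu => ?_
    refine (pointwise hstep hF hG hzero hp ht.1 ht.2 hu.1 hu.2).trans ?_
    have hphi : ∀ v, 0 < v → phi p t F v ≤ ⨆ u ∈ Ioo 0 t, ENNReal.ofReal (u ^ (1 / p)) * F u := by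
      intro v hv
      unfold phi
      split_ifs with h
      · exact le_iSup₂_of_le v ⟨hv, h⟩ le_rfl
      · exact zero_le
    refine mul_le_mul_right (sup_le (iSup_le fun k => ?_) (hphi _ ?_)) C2
    · refine le_trans ?_ (hphi (2 ^ k * u) (by have := hu.1; positivity))
      exact mul_le_of_le_one_left' (pow_le_one' hq1.le _)
    · have := hu.1
      have : 0 < 1 - Real.log t := by have := Real.log_neg ht.1 ht.2; linarith
      positivity
  · set ρ := r.toReal with hρ
    have hρ0 : 0 < ρ := ENNReal.toReal_pos hr.ne' hrt
    have hqr : q ^ ρ < 1 := ENNReal.rpow_lt_one hq1 hρ0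
    refine ⟨C2 ^ ρ * (∑' k : ℕ, (q ^ ρ) ^ k + 1), ?_, fun G F hG hF hstep hzero t ht => ?_⟩
    · have := hgeo _ hqr
      have := ENNReal.rpow_ne_top_of_nonneg hρ0.le hC2t
      finiteness
    simp only [qint, if_neg hrt]
    have hL : 0 < 1 - Real.log t := by have := Real.log_neg ht.1 ht.2; linarith
    set κ := (1 - Real.log t) ^ p with hκ
    have hκ0 : 0 < κ := by positivity
    set ψ : ℝ → ℝ≥0∞ := fun v => phi p t F v ^ ρ with hψ
    have hphim : Measurable (phi p t F) := by
      unfold phi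
      refine Measurable.ite measurableSet_Iio ?_ measurable_const
      exact Measurable.mul (by fun_prop) hF.measurable
    have hψm : Measurable ψ := hphim.pow_const _
    have hJ : ∫⁻ v in Ioi (0:ℝ), ψ v / ENNReal.ofReal v =
        ∫⁻ u in Ioo 0 t, (ENNReal.ofReal (u ^ (1 / p)) * F u) ^ ρ / ENNReal.ofReal u := by
      rw [← lintegral_indicator measurableSet_Ioi, ← lintegral_indicator measurableSet_Ioo]
      congr 1
      ext v
      by_cases hv : v ∈ Ioi (0:ℝ)
      · by_cases hvt : v < t
        · have : v ∈ Ioo 0 t := ⟨hv, hvt⟩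
          simp [hv, this, hψ, phi, hvt]
        · have : v ∉ Ioo 0 t := fun h => hvt h.2
          simp [hv, this, hψ, phi, hvt, hρ0]
      · have : v ∉ Ioo 0 t := fun h => hv h.1
        rw [indicator_of_notMem hv, indicator_of_notMem this]
    rw [← hJ]
    set J := ∫⁻ v in Ioi (0:ℝ), ψ v / ENNReal.ofReal v
    calc _ ≤ ∫⁻ u in Ioo 0 (t * (1 - Real.log t) ^ (-p)),
          C2 ^ ρ * ((∑' k : ℕ, (q ^ ρ) ^ k * (ψ (2 ^ k * u) / ENNReal.ofReal u)) +
            ψ (κ * u) / ENNReal.ofReal u) := by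
          refine setLIntegral_mono' measurableSet_Ioo fun u hu => ?_
          have h1 := pointwise hstep hF hG hzero hp ht.1 ht.2 hu.1 hu.2
          rw [← hq, ← hC2, ← hκ] at h1
          have h2 := ENNReal.rpow_le_rpow h1 hρ0.le
          rw [ENNReal.mul_rpow_of_nonneg C2 _ hρ0.le] at h2
          have h3 : ((⨆ k : ℕ, q ^ k * phi p t F (2 ^ k * u)) ⊔ phi p t F (κ * u)) ^ ρ ≤
              (∑' k : ℕ, (q ^ ρ) ^ k * ψ (2 ^ k * u)) + ψ (κ * u) := by
            have hm : Monotone fun x : ℝ≥0∞ => x ^ ρ := ENNReal.monotone_rpow_of_nonneg hρ0.le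
            rw [hm.map_sup]
            refine sup_le (le_trans ?_ le_self_add) le_add_self
            have e : (⨆ k : ℕ, q ^ k * phi p t F (2 ^ k * u)) ^ ρ =
                ⨆ k : ℕ, (q ^ k * phi p t F (2 ^ k * u)) ^ ρ :=
              (ENNReal.orderIsoRpow ρ hρ0).map_iSup _
            rw [e]
            refine iSup_le fun k => ?_
            rw [ENNReal.mul_rpow_of_nonneg _ _ hρ0.le, ← ENNReal.rpow_natCast, ← ENNReal.rpow_mul,
              mul_comm (k : ℝ) ρ, ENNReal.rpow_mul, ENNReal.rpow_natCast]
            exact ENNReal.le_tsum (f := fun k : ℕ => (q ^ ρ) ^ k * ψ (2 ^ k * u)) k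
          have h4 := h2.trans (mul_le_mul_right h3 _)
          calc _ ≤ C2 ^ ρ * ((∑' k : ℕ, (q ^ ρ) ^ k * ψ (2 ^ k * u)) + ψ (κ * u)) /
                ENNReal.ofReal u := ENNReal.div_le_div_right h4 _
            _ = _ := by
              simp only [div_eq_mul_inv, ← mul_assoc, ENNReal.tsum_mul_right]
              ring
      _ ≤ ∫⁻ u in Ioi (0:ℝ),
          C2 ^ ρ * ((∑' k : ℕ, (q ^ ρ) ^ k * (ψ (2 ^ k * u) / ENNReal.ofReal u)) +
            ψ (κ * u) / ENNReal.ofReal u) := lintegral_mono_set Ioo_subset_Ioi_self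
      _ = C2 ^ ρ * (∑' k : ℕ, (q ^ ρ) ^ k * J + J) := by
          have hm1 : ∀ s : ℝ, Measurable fun u : ℝ => ψ (s * u) / ENNReal.ofReal u := fun s =>
            (hψm.comp (measurable_const_mul s)).div (by fun_prop)
          rw [lintegral_const_mul _ (by
            refine Measurable.add (Measurable.tsum fun k => ?_) (hm1 κ)
            exact (hm1 _).const_mul _),
            lintegral_add_right _ (hm1 κ), scale ψ hκ0,
            lintegral_tsum (fun k => ((hm1 _).const_mul _).aemeasurable)]
          congr 3
          ext k
          rw [lintegral_const_mul _ (hm1 _), scale ψ (by positivity)]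
      _ = _ := by rw [ENNReal.tsum_mul_right]; ring

/-- A logarithmic Bennett–DeVore–Sharpley inequality for doubling measures
(Theorem 1.9, inequality (1.22)). -/
theorem statement7 (d : ℕ) (hd : 0 < d) (μ : Measure (Euc d))
    [IsLocallyFiniteMeasure μ] [μ.Regular]
    (hdoubling : ∃ c : ℝ≥0∞, c ≠ ∞ ∧ ∀ (a : Fin d → ℝ) (l : ℝ), 0 < l →
      μ (cubeSet (fun i => a i - l / 2) (2 * l)) ≤ c * μ (cubeSet a l))
    (Q0 : Set (Euc d)) (hQ0 : IsCube Q0) (p : ℝ) (hp : 1 < p) (r : ℝ≥0∞) (hr : 0 < r) :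
    ∃ C : ℝ, 0 < C ∧ ∀ f : Euc d → ℝ, Measurable f →
      Integrable f (μ.restrict Q0) →
      lorentz (μ.restrict Q0) f p r (Set.Ioo 0 1) ≠ ∞ →
      ∀ t ∈ Set.Ioo (0 : ℝ) 1,
        qint r (Set.Ioo 0 (t * (1 - Real.log t) ^ (-p)))
            (fun u => ENNReal.ofReal (u ^ (1 / p)) *
              rearrR (μ.restrict Q0) (fun x => f x - ⨍ z in Q0, f z ∂μ) u) ≤
          ENNReal.ofReal C *
            qint r (Set.Ioo 0 t)
              (fun u => ENNReal.ofReal (u ^ (1 / p)) *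
                rearr (μ.restrict Q0) (sharpLocal μ Q0 f) u) := by
  obtain ⟨c, hc, hdoub⟩ := hdoubling
  obtain ⟨a, l, hl, rfl⟩ := hQ0
  rw [cubeSet_eq_supBall]
  set c0 : Euc d := WithLp.toLp 2 fun i => a i + l / 2
  set R := l / 2 with hRdef
  have hR : 0 < R := by positivity
  have hdoub' : ∀ (z : Euc d) (h : ℝ), 0 < h → μ (supBall z (2 * h)) ≤ c * μ (supBall z h) := by
    intro z h hh
    have := hdoub (fun i => z i - h) (2 * h) (by positivity)
    rw [supBall_eq_cubeSet, supBall_eq_cubeSet]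
    convert this using 4
    ring
  have hQfin : μ (supBall c0 R) ≠ ∞ := (supBall_isCompact _ _).measure_ne_top
  obtain ⟨C, hC, h⟩ := final (16 * (c ^ 5 + 1)) (by finiteness) (μ (supBall c0 R)).toReal p hp r hr
  refine ⟨C, hC, fun f hfm hf _ t ht => ?_⟩
  refine h _ _ (rearr_anti _ _) (rearr_anti _ _) (step hc hdoub' hR hfm hf) (fun t ht => ?_) t ht
  rw [← nonpos_iff_eq_zero]
  refine rearr_le (le_trans (measure_mono (subset_univ _)) ?_)
  rw [Measure.restrict_apply_univ]
  exact ENNReal.le_ofReal_iff_toReal_le hQfin (ENNReal.toReal_nonneg.trans ht) |>.2 ht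

end
end
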